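/- Global existence and uniqueness for the 1D toy model: if f₀ : ℝ×ℝ → ℝ is continuously differentiable with compact support, A₀ : ℝ → ℝ is twice continuously differentiable with compact support, and A₁ : ℝ → ℝ is continuously differentiable with compact support, then there exists exactly one continuously differentiable function f : [0,∞)×ℝ×ℝ → ℝ such that f(0,·,·) = f₀, for every T > 0 the restriction of f to [0,T]×ℝ×ℝ has compact support, and f satisfies pointwise the transport equation ∂ₜf(t,x,v) + v̂ ∂ₓf(t,x,v) − ∂ₜA(t,x) ∂ᵥf(t,x,v) = 0, where A : [0,∞)×ℝ → ℝ is the function given by the d'Alembert formula with data (A₀, A₁) and source j_f; moreover this A is twice continuously differentiable and satisfies ∂ₜₜA(t,x) − ∂ₓₓA(t,x) = j_f(t,x) pointwise. -/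

import Mathlib

open MeasureTheory Set intervalIntegral

/-- The relativistic velocity `v̂ = v / √(1+v²)`. -/
noncomputable def vhat (v : ℝ) : ℝ := v / Real.sqrt (1 + v ^ 2)

/-- The current density `j_f(t,x) = ∫ v̂ f(t,x,v) dv`. -/
noncomputable def jcur (f : ℝ → ℝ → ℝ → ℝ) (t x : ℝ) : ℝ := ∫ v : ℝ, vhat v * f t x v

/-- The d'Alembert formula: the solution of the 1D wave equation `□A = j`
with initial data `A(0,·) = A₀`, `∂ₜA(0,·) = A₁` and source `j`. -/
noncomputable def dAlembert (A₀ A₁ : ℝ → ℝ) (j : ℝ → ℝ → ℝ) (t x : ℝ) : ℝ :=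
  (A₀ (x + t) + A₀ (x - t)) / 2 + (∫ s in (x - t)..(x + t), A₁ s) / 2
    + (∫ s in (0:ℝ)..t, ∫ y in (x - (t - s))..(x + (t - s)), j s y) / 2

/-- The partial derivative in the first (time) variable. -/
noncomputable def pt (F : ℝ → ℝ → ℝ) (t x : ℝ) : ℝ := deriv (fun s => F s x) t

/-- The partial derivative in the second (space) variable. -/
noncomputable def px (F : ℝ → ℝ → ℝ) (t x : ℝ) : ℝ := deriv (fun y => F t y) x

/-- `f` is a global classical solution of the toy model on `[0,∞) × ℝ × ℝ` with data
`(f₀, A₀, A₁)`: `f` is continuously differentiable, `f(0,·,·) = f₀`, for every `T > 0` the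
restriction of `f` to `[0,T] × ℝ × ℝ` has compact support, `f` satisfies pointwise the
transport equation `∂ₜf + v̂ ∂ₓf - ∂ₜA ∂ᵥf = 0` where `A` is given by the d'Alembert
formula with data `(A₀, A₁)` and source `j_f`, and moreover this `A` is twice continuously
differentiable and satisfies `∂ₜₜA - ∂ₓₓA = j_f` pointwise. -/
def IsGlobalToySolution (f₀ : ℝ → ℝ → ℝ) (A₀ A₁ : ℝ → ℝ) (f : ℝ → ℝ → ℝ → ℝ) : Prop :=
  ContDiff ℝ 1 (fun p : ℝ × ℝ × ℝ => f p.1 p.2.1 p.2.2) ∧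
  (∀ x v : ℝ, f 0 x v = f₀ x v) ∧
  (∀ T > (0:ℝ), ∃ R : ℝ, ∀ t ∈ Icc (0:ℝ) T, ∀ x v : ℝ,
      R < |x| ∨ R < |v| → f t x v = 0) ∧
  (∀ t ≥ (0:ℝ), ∀ x v : ℝ,
      deriv (fun s => f s x v) t + vhat v * deriv (fun y => f t y v) x
        - pt (dAlembert A₀ A₁ (jcur f)) t x * deriv (fun w => f t x w) v = 0) ∧
  ContDiffOn ℝ 2 (fun p : ℝ × ℝ => dAlembert A₀ A₁ (jcur f) p.1 p.2)
    (Ici (0:ℝ) ×ˢ univ) ∧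
  (∀ t ≥ (0:ℝ), ∀ x : ℝ,
      pt (pt (dAlembert A₀ A₁ (jcur f))) t x - px (px (dAlembert A₀ A₁ (jcur f))) t x
        = jcur f t x)

theorem hasFDerivAt_partials {F : Type*} [NormedAddCommGroup F] [NormedSpace ℝ F]
    {g g1 g2 : ℝ → ℝ → F}
    (h1 : ∀ x y, HasDerivAt (fun s => g s y) (g1 x y) x)
    (h2 : ∀ x y, HasDerivAt (fun s => g x s) (g2 x y) y)
    (c1 : Continuous fun p : ℝ × ℝ => g1 p.1 p.2)
    (c2 : Continuous fun p : ℝ × ℝ => g2 p.1 p.2) (p : ℝ × ℝ) :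
    HasFDerivAt (fun p : ℝ × ℝ => g p.1 p.2)
      ((ContinuousLinearMap.fst ℝ ℝ ℝ).smulRight (g1 p.1 p.2) +
        (ContinuousLinearMap.snd ℝ ℝ ℝ).smulRight (g2 p.1 p.2)) p := by
  have h := hasStrictFDerivAt_uncurry_coprod (𝕜 := ℝ) (u := p) (f := g)
    (f₁ := fun x y => ContinuousLinearMap.toSpanSingleton ℝ (g1 x y))
    (f₂ := fun x y => ContinuousLinearMap.toSpanSingleton ℝ (g2 x y))
    (Filter.Eventually.of_forall fun v => (h1 v.1 v.2).hasFDerivAt)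
    (Filter.Eventually.of_forall fun v => (h2 v.1 v.2).hasFDerivAt)
    (by
      have : Continuous fun p : ℝ × ℝ =>
        ContinuousLinearMap.toSpanSingleton ℝ (g1 p.1 p.2) :=
          (ContinuousLinearMap.toSpanSingletonCLE (𝕜 := ℝ) (E := F)).continuous.comp c1
      exact this.continuousAt)
    (by
      have : Continuous fun p : ℝ × ℝ =>
        ContinuousLinearMap.toSpanSingleton ℝ (g2 p.1 p.2) :=
          (ContinuousLinearMap.toSpanSingletonCLE (𝕜 := ℝ) (E := F)).continuous.comp c2
      exact this.continuousAt)
  convert! h.hasFDerivAt using 1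

theorem contDiff_one_partials {g g1 g2 : ℝ → ℝ → ℝ}
    (h1 : ∀ x y, HasDerivAt (fun s => g s y) (g1 x y) x)
    (h2 : ∀ x y, HasDerivAt (fun s => g x s) (g2 x y) y)
    (c1 : Continuous fun p : ℝ × ℝ => g1 p.1 p.2)
    (c2 : Continuous fun p : ℝ × ℝ => g2 p.1 p.2) :
    ContDiff ℝ 1 (fun p : ℝ × ℝ => g p.1 p.2) := by
  rw [show (1 : WithTop ℕ∞) = ((0:ℕ) : WithTop ℕ∞) + 1 by simp, contDiff_succ_iff_hasFDerivAt]
  refine ⟨_, ?_, hasFDerivAt_partials h1 h2 c1 c2⟩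
  rw [Nat.cast_zero, contDiff_zero]
  fun_prop

theorem contDiff_two_partials {g g1 g2 : ℝ → ℝ → ℝ}
    (h1 : ∀ x y, HasDerivAt (fun s => g s y) (g1 x y) x)
    (h2 : ∀ x y, HasDerivAt (fun s => g x s) (g2 x y) y)
    (c1 : ContDiff ℝ 1 fun p : ℝ × ℝ => g1 p.1 p.2)
    (c2 : ContDiff ℝ 1 fun p : ℝ × ℝ => g2 p.1 p.2) :
    ContDiff ℝ 2 (fun p : ℝ × ℝ => g p.1 p.2) := by
  rw [show (2 : WithTop ℕ∞) = ((1:ℕ) : WithTop ℕ∞) + 1 by norm_num, contDiff_succ_iff_hasFDerivAt]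
  refine ⟨_, ?_, hasFDerivAt_partials h1 h2 c1.continuous c2.continuous⟩
  rw [Nat.cast_one]
  fun_prop

/-- integral along a light ray. -/
noncomputable def II (σ : ℝ) (G : ℝ → ℝ → ℝ) (t x : ℝ) : ℝ :=
  ∫ s in (0:ℝ)..t, G s (x + σ * (t - s))

theorem II_cont (σ : ℝ) {G : ℝ → ℝ → ℝ} (hG : Continuous fun p : ℝ × ℝ => G p.1 p.2) :
    Continuous fun p : ℝ × ℝ => II σ G p.1 p.2 := by
  unfold II
  apply intervalIntegral.continuous_parametric_intervalIntegral_of_continuous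
    (f := fun (p : ℝ × ℝ) s => G s (p.2 + σ * (p.1 - s)))
  · exact hG.comp (f := fun q : (ℝ × ℝ) × ℝ => (q.2, q.1.2 + σ * (q.1.1 - q.2))) (by fun_prop)
  · fun_prop

theorem hasDerivAt_param_integral {H H' : ℝ → ℝ → ℝ}
    (hH : Continuous fun p : ℝ × ℝ => H p.1 p.2) (hH' : Continuous fun p : ℝ × ℝ => H' p.1 p.2)
    (hd : ∀ s y, HasDerivAt (fun y => H s y) (H' s y) y) (a b y : ℝ) :
    HasDerivAt (fun y => ∫ s in a..b, H s y) (∫ s in a..b, H' s y) y := by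
  have hK : IsCompact (uIcc a b ×ˢ Metric.closedBall y 1) :=
    isCompact_uIcc.prod (isCompact_closedBall y 1)
  obtain ⟨C, hC⟩ := hK.exists_bound_of_continuousOn hH'.continuousOn
  refine (intervalIntegral.hasDerivAt_integral_of_dominated_loc_of_deriv_le (bound := fun _ => C)
    (F := fun y s => H s y) (F' := fun y s => H' s y) (s := Metric.ball y 1)
    (Metric.ball_mem_nhds y one_pos) ?_ ?_ ?_ ?_ ?_ ?_).2
  · refine Filter.Eventually.of_forall fun z => Continuous.aestronglyMeasurable ?_
    exact hH.comp (f := fun s : ℝ => (s, z)) (by fun_prop)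
  · refine Continuous.intervalIntegrable ?_ _ _
    exact hH.comp (f := fun s : ℝ => (s, y)) (by fun_prop)
  · refine Continuous.aestronglyMeasurable ?_
    exact hH'.comp (f := fun s : ℝ => (s, y)) (by fun_prop)
  · refine Filter.Eventually.of_forall fun s hs z hz => ?_
    exact hC (s, z) ⟨uIoc_subset_uIcc hs, Metric.ball_subset_closedBall hz⟩
  · exact intervalIntegrable_const
  · exact Filter.Eventually.of_forall fun s hs z hz => hd s z

theorem II_hasDerivAt_x (σ : ℝ) {G G' : ℝ → ℝ → ℝ}
    (hG : Continuous fun p : ℝ × ℝ => G p.1 p.2) (hG' : Continuous fun p : ℝ × ℝ => G' p.1 p.2)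
    (hd : ∀ s y, HasDerivAt (fun y => G s y) (G' s y) y) (t x : ℝ) :
    HasDerivAt (fun x => II σ G t x) (II σ G' t x) x := by
  unfold II
  apply hasDerivAt_param_integral (H := fun s x => G s (x + σ * (t - s)))
    (H' := fun s x => G' s (x + σ * (t - s)))
  · exact hG.comp (f := fun q : ℝ × ℝ => (q.1, q.2 + σ * (t - q.1))) (by fun_prop)
  · exact hG'.comp (f := fun q : ℝ × ℝ => (q.1, q.2 + σ * (t - q.1))) (by fun_prop)
  · intro s y
    exact (hd s (y + σ * (t - s))).comp_add_const y _

theorem II_hasDerivAt_t (σ : ℝ) {G G' : ℝ → ℝ → ℝ}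
    (hG : Continuous fun p : ℝ × ℝ => G p.1 p.2) (hG' : Continuous fun p : ℝ × ℝ => G' p.1 p.2)
    (hd : ∀ s y, HasDerivAt (fun y => G s y) (G' s y) y) (t x : ℝ) :
    HasDerivAt (fun t => II σ G t x) (G t x + σ * II σ G' t x) t := by
  have cH : Continuous fun p : ℝ × ℝ => G p.1 (p.2 - σ * p.1) :=
    hG.comp (f := fun q : ℝ × ℝ => (q.1, q.2 - σ * q.1)) (by fun_prop)
  have cH' : Continuous fun p : ℝ × ℝ => G' p.1 (p.2 - σ * p.1) :=
    hG'.comp (f := fun q : ℝ × ℝ => (q.1, q.2 - σ * q.1)) (by fun_prop)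
  have key := hasFDerivAt_partials (g := fun u y => ∫ s in (0:ℝ)..u, G s (y - σ * s))
    (g1 := fun u y => G u (y - σ * u)) (g2 := fun u y => ∫ s in (0:ℝ)..u, G' s (y - σ * s))
    (fun u y => by
      have c : Continuous fun s => G s (y - σ * s) :=
        hG.comp (f := fun q : ℝ => (q, y - σ * q)) (by fun_prop)
      exact integral_hasDerivAt_right (c.intervalIntegrable _ _)
        c.stronglyMeasurable.stronglyMeasurableAtFilter c.continuousAt)
    (fun u y => hasDerivAt_param_integral (H := fun s y => G s (y - σ * s))
      (H' := fun s y => G' s (y - σ * s)) cH cH'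
      (fun s y => (hd s (y - σ * s)).comp_sub_const y _) 0 u y)
    cH
    (by
      apply intervalIntegral.continuous_parametric_intervalIntegral_of_continuous
        (f := fun (p : ℝ × ℝ) s => G' s (p.2 - σ * s))
      · exact hG'.comp (f := fun q : (ℝ × ℝ) × ℝ => (q.2, q.1.2 - σ * q.2)) (by fun_prop)
      · fun_prop)
    (t, x + σ * t)
  have hc : HasDerivAt (fun t : ℝ => ((t, x + σ * t) : ℝ × ℝ)) (1, σ) t := by
    refine (hasDerivAt_id t).prodMk ?_
    simpa using ((hasDerivAt_id t).const_mul σ).const_add x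
  have := key.comp_hasDerivAt t hc
  convert! this using 1
  · funext t
    simp only [II, Function.comp]
    congr 1; funext s; congr 1; ring
  · simp only [II]
    simp
    left
    congr 1; funext s; congr 1; ring

/-- the formula for the time derivative of A -/
noncomputable def EE (A₀ A₁ : ℝ → ℝ) (j : ℝ → ℝ → ℝ) (t x : ℝ) : ℝ :=
  (deriv A₀ (x + t) - deriv A₀ (x - t)) / 2 + (A₁ (x + t) + A₁ (x - t)) / 2
    + (II 1 j t x + II (-1) j t x) / 2

/-- the formula for the space derivative of A -/
noncomputable def EX (A₀ A₁ : ℝ → ℝ) (j : ℝ → ℝ → ℝ) (t x : ℝ) : ℝ :=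
  (deriv A₀ (x + t) + deriv A₀ (x - t)) / 2 + (A₁ (x + t) - A₁ (x - t)) / 2
    + (II 1 j t x - II (-1) j t x) / 2

section
variable {A₀ A₁ : ℝ → ℝ} {j j' : ℝ → ℝ → ℝ}

theorem prim_cont (hj : Continuous fun p : ℝ × ℝ => j p.1 p.2) :
    Continuous fun p : ℝ × ℝ => ∫ y in (0:ℝ)..p.2, j p.1 y := by
  apply intervalIntegral.continuous_parametric_intervalIntegral_of_continuous
    (f := fun (p : ℝ × ℝ) s => j p.1 s)
  · exact hj.comp (f := fun q : (ℝ × ℝ) × ℝ => (q.1.1, q.2)) (by fun_prop)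
  · fun_prop

theorem prim_deriv (hj : Continuous fun p : ℝ × ℝ => j p.1 p.2) (s y : ℝ) :
    HasDerivAt (fun y => ∫ z in (0:ℝ)..y, j s z) (j s y) y := by
  have c : Continuous fun z => j s z := hj.comp (f := fun q : ℝ => (s, q)) (by fun_prop)
  exact integral_hasDerivAt_right (c.intervalIntegrable _ _)
        c.stronglyMeasurable.stronglyMeasurableAtFilter c.continuousAt

theorem dAlembert_eq (hA₁ : Continuous A₁) (hj : Continuous fun p : ℝ × ℝ => j p.1 p.2) (t x : ℝ) :
    dAlembert A₀ A₁ j t x = (A₀ (x + t) + A₀ (x - t)) / 2 +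
      ((∫ s in (0:ℝ)..(x+t), A₁ s) - (∫ s in (0:ℝ)..(x-t), A₁ s)) / 2
      + (II 1 (fun s y => ∫ z in (0:ℝ)..y, j s z) t x
          - II (-1) (fun s y => ∫ z in (0:ℝ)..y, j s z) t x) / 2 := by
  unfold dAlembert II
  have hc : ∀ σ : ℝ, Continuous fun s => ∫ z in (0:ℝ)..(x + σ * (t - s)), j s z := fun σ =>
    (prim_cont hj).comp (f := fun q : ℝ => (q, x + σ * (t - q))) (by fun_prop)
  rw [← intervalIntegral.integral_sub ((hc 1).intervalIntegrable _ _)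
    ((hc (-1)).intervalIntegrable _ _),
    ← integral_interval_sub_left (hA₁.intervalIntegrable _ _) (hA₁.intervalIntegrable _ _)]
  congr 2
  apply intervalIntegral.integral_congr
  intro s _
  have c : Continuous fun z => j s z := hj.comp (f := fun q : ℝ => (s, q)) (by fun_prop)
  simp only
  rw [integral_interval_sub_left (c.intervalIntegrable _ _) (c.intervalIntegrable _ _)]
  congr 1 <;> ring

theorem dAlembert_hasDerivAt_t (hA₀ : ContDiff ℝ 1 A₀) (hA₁ : Continuous A₁)
    (hj : Continuous fun p : ℝ × ℝ => j p.1 p.2) (t x : ℝ) :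
    HasDerivAt (fun t => dAlembert A₀ A₁ j t x) (EE A₀ A₁ j t x) t := by
  rw [show (fun t => dAlembert A₀ A₁ j t x) = _ from funext fun t => dAlembert_eq hA₁ hj t x]
  have hA : ∀ y, HasDerivAt A₀ (deriv A₀ y) y := fun y =>
    (hA₀.differentiable (by simp) y).hasDerivAt
  have hB : ∀ y, HasDerivAt (fun y => ∫ s in (0:ℝ)..y, A₁ s) (A₁ y) y := fun y =>
    integral_hasDerivAt_right (hA₁.intervalIntegrable _ _)
        hA₁.stronglyMeasurable.stronglyMeasurableAtFilter hA₁.continuousAt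
  have h1 := ((hA (x + t)).comp_const_add x t).add ((hA (x - t)).comp_const_sub x t)
  have h2 := ((hB (x + t)).comp_const_add x t).sub ((hB (x - t)).comp_const_sub x t)
  have h3 := (II_hasDerivAt_t 1 (prim_cont hj) hj (prim_deriv hj) t x).sub
    (II_hasDerivAt_t (-1) (prim_cont hj) hj (prim_deriv hj) t x)
  convert! ((h1.div_const 2).add (h2.div_const 2)).add (h3.div_const 2) using 1
  unfold EE; ring

theorem dAlembert_hasDerivAt_x (hA₀ : ContDiff ℝ 1 A₀) (hA₁ : Continuous A₁)
    (hj : Continuous fun p : ℝ × ℝ => j p.1 p.2) (t x : ℝ) :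
    HasDerivAt (fun x => dAlembert A₀ A₁ j t x) (EX A₀ A₁ j t x) x := by
  rw [show (fun x => dAlembert A₀ A₁ j t x) = _ from funext fun x => dAlembert_eq hA₁ hj t x]
  have hA : ∀ y, HasDerivAt A₀ (deriv A₀ y) y := fun y =>
    (hA₀.differentiable (by simp) y).hasDerivAt
  have hB : ∀ y, HasDerivAt (fun y => ∫ s in (0:ℝ)..y, A₁ s) (A₁ y) y := fun y =>
    integral_hasDerivAt_right (hA₁.intervalIntegrable _ _)
        hA₁.stronglyMeasurable.stronglyMeasurableAtFilter hA₁.continuousAt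
  have h1 := ((hA (x + t)).comp_add_const x t).add ((hA (x - t)).comp_sub_const x t)
  have h2 := ((hB (x + t)).comp_add_const x t).sub ((hB (x - t)).comp_sub_const x t)
  have h3 := (II_hasDerivAt_x 1 (prim_cont hj) hj (prim_deriv hj) t x).sub
    (II_hasDerivAt_x (-1) (prim_cont hj) hj (prim_deriv hj) t x)
  convert! ((h1.div_const 2).add (h2.div_const 2)).add (h3.div_const 2) using 1

theorem EE_cont (hA₀ : ContDiff ℝ 1 A₀) (hA₁ : Continuous A₁)
    (hj : Continuous fun p : ℝ × ℝ => j p.1 p.2) :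
    Continuous fun p : ℝ × ℝ => EE A₀ A₁ j p.1 p.2 := by
  unfold EE
  have h1 := II_cont 1 hj
  have h2 := II_cont (-1) hj
  have h3 := hA₀.continuous_deriv (by simp)
  fun_prop

/-- derivative data of order two. -/
theorem EE_EX_derivs (hA₀ : ContDiff ℝ 2 A₀) (hA₁ : ContDiff ℝ 1 A₁)
    (hj : Continuous fun p : ℝ × ℝ => j p.1 p.2) (hj' : Continuous fun p : ℝ × ℝ => j' p.1 p.2)
    (hd : ∀ s y, HasDerivAt (fun y => j s y) (j' s y) y) :
    (∀ t x, HasDerivAt (fun x => EE A₀ A₁ j t x) (EE (deriv A₀) (deriv A₁) j' t x) x) ∧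
    (∀ t x, HasDerivAt (fun x => EX A₀ A₁ j t x) (EX (deriv A₀) (deriv A₁) j' t x) x) ∧
    (∀ t x, HasDerivAt (fun t => EE A₀ A₁ j t x) (j t x + EX (deriv A₀) (deriv A₁) j' t x) t) ∧
    (∀ t x, HasDerivAt (fun t => EX A₀ A₁ j t x) (EE (deriv A₀) (deriv A₁) j' t x) t) := by
  have hA' : ContDiff ℝ 1 (deriv A₀) :=
    ((contDiff_succ_iff_deriv (n := 1)).1 (by simpa [one_add_one_eq_two] using hA₀)).2.2
  have hA : ∀ y, HasDerivAt (deriv A₀) (deriv (deriv A₀) y) y := fun y =>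
    (hA'.differentiable (by simp) y).hasDerivAt
  have hB : ∀ y, HasDerivAt A₁ (deriv A₁ y) y := fun y =>
    (hA₁.differentiable (by simp) y).hasDerivAt
  refine ⟨fun t x => ?_, fun t x => ?_, fun t x => ?_, fun t x => ?_⟩
  · have h1 := ((hA (x + t)).comp_add_const x t).sub ((hA (x - t)).comp_sub_const x t)
    have h2 := ((hB (x + t)).comp_add_const x t).add ((hB (x - t)).comp_sub_const x t)
    have h3 := (II_hasDerivAt_x 1 hj hj' hd t x).add (II_hasDerivAt_x (-1) hj hj' hd t x)
    convert! ((h1.div_const 2).add (h2.div_const 2)).add (h3.div_const 2) using 1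
  · have h1 := ((hA (x + t)).comp_add_const x t).add ((hA (x - t)).comp_sub_const x t)
    have h2 := ((hB (x + t)).comp_add_const x t).sub ((hB (x - t)).comp_sub_const x t)
    have h3 := (II_hasDerivAt_x 1 hj hj' hd t x).sub (II_hasDerivAt_x (-1) hj hj' hd t x)
    convert! ((h1.div_const 2).add (h2.div_const 2)).add (h3.div_const 2) using 1
  · have h1 := ((hA (x + t)).comp_const_add x t).sub ((hA (x - t)).comp_const_sub x t)
    have h2 := ((hB (x + t)).comp_const_add x t).add ((hB (x - t)).comp_const_sub x t)
    have h3 := (II_hasDerivAt_t 1 hj hj' hd t x).add (II_hasDerivAt_t (-1) hj hj' hd t x)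
    convert! ((h1.div_const 2).add (h2.div_const 2)).add (h3.div_const 2) using 1
    unfold EX; ring
  · have h1 := ((hA (x + t)).comp_const_add x t).add ((hA (x - t)).comp_const_sub x t)
    have h2 := ((hB (x + t)).comp_const_add x t).sub ((hB (x - t)).comp_const_sub x t)
    have h3 := (II_hasDerivAt_t 1 hj hj' hd t x).sub (II_hasDerivAt_t (-1) hj hj' hd t x)
    convert! ((h1.div_const 2).add (h2.div_const 2)).add (h3.div_const 2) using 1
    unfold EE; ring

theorem EX_cont (hA₀ : ContDiff ℝ 1 A₀) (hA₁ : Continuous A₁)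
    (hj : Continuous fun p : ℝ × ℝ => j p.1 p.2) :
    Continuous fun p : ℝ × ℝ => EX A₀ A₁ j p.1 p.2 := by
  unfold EX
  have h1 := II_cont 1 hj
  have h2 := II_cont (-1) hj
  have h3 := hA₀.continuous_deriv (by simp)
  fun_prop

theorem dAlembert_main (hA₀ : ContDiff ℝ 2 A₀) (hA₁ : ContDiff ℝ 1 A₁)
    (hj : Continuous fun p : ℝ × ℝ => j p.1 p.2) (hj' : Continuous fun p : ℝ × ℝ => j' p.1 p.2)
    (hd : ∀ s y, HasDerivAt (fun y => j s y) (j' s y) y) :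
    ContDiff ℝ 2 (fun p : ℝ × ℝ => dAlembert A₀ A₁ j p.1 p.2) ∧
    (∀ t x, pt (dAlembert A₀ A₁ j) t x = EE A₀ A₁ j t x) ∧
    (∀ t x, pt (pt (dAlembert A₀ A₁ j)) t x - px (px (dAlembert A₀ A₁ j)) t x = j t x) := by
  have hA' : ContDiff ℝ 1 (deriv A₀) :=
    ((contDiff_succ_iff_deriv (n := 1)).1 (by simpa [one_add_one_eq_two] using hA₀)).2.2
  have hB' : Continuous (deriv A₁) := hA₁.continuous_deriv (by simp)
  obtain ⟨e1, e2, e3, e4⟩ := EE_EX_derivs hA₀ hA₁ hj hj' hd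
  have hA₀1 : ContDiff ℝ 1 A₀ := hA₀.of_le (by norm_num)
  have h1 := dAlembert_hasDerivAt_t hA₀1 hA₁.continuous hj
  have h2 := dAlembert_hasDerivAt_x hA₀1 hA₁.continuous hj
  have p1 : pt (dAlembert A₀ A₁ j) = EE A₀ A₁ j := by
    funext t x; exact (h1 t x).deriv
  have p2 : px (dAlembert A₀ A₁ j) = EX A₀ A₁ j := by
    funext t x; exact (h2 t x).deriv
  refine ⟨contDiff_two_partials h1 h2 ?_ ?_, fun t x => by rw [p1], fun t x => ?_⟩
  · exact contDiff_one_partials e3 e1 (hj.add (EX_cont hA' hB' hj')) (EE_cont hA' hB' hj')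
  · exact contDiff_one_partials e4 e2 (EE_cont hA' hB' hj') (EX_cont hA' hB' hj')
  · rw [p1, p2]
    unfold pt px
    rw [(e3 t x).deriv, (e2 t x).deriv]; ring
end

theorem integral_eq_interval {h : ℝ → ℝ} {P : ℝ} (hP : 0 ≤ P) (hz : ∀ v, P < |v| → h v = 0) :
    ∫ v, h v = ∫ v in (-P)..P, h v := by
  rw [intervalIntegral.integral_of_le (by linarith), ← integral_Icc_eq_integral_Ioc,
    setIntegral_eq_integral_of_forall_compl_eq_zero]
  intro v hv
  apply hz
  by_contra hc
  exact hv (abs_le.1 (not_lt.1 hc))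

theorem cont_mom {X : Type*} [TopologicalSpace X] {a : ℝ → ℝ} (ha : Continuous a)
    {H : X → ℝ → ℝ} (hH : Continuous fun p : X × ℝ => H p.1 p.2)
    (hs : ∀ s₀, ∃ P : ℝ, ∀ᶠ s in nhds s₀, ∀ v, P < |v| → H s v = 0) :
    Continuous fun s => ∫ v, a v * H s v := by
  rw [continuous_iff_continuousAt]
  intro s₀
  obtain ⟨P, hP⟩ := hs s₀
  have h1 : Continuous fun s => ∫ v in (-|P|)..|P|, a v * H s v := by
    apply intervalIntegral.continuous_parametric_intervalIntegral_of_continuous'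
      (f := fun s v => a v * H s v)
    exact (ha.comp continuous_snd).mul hH
  refine h1.continuousAt.congr ?_
  filter_upwards [hP] with s hs
  refine (integral_eq_interval (abs_nonneg P) fun v hv => ?_).symm
  rw [hs v (lt_of_le_of_lt (le_abs_self P) hv), mul_zero]

theorem hasDerivAt_mom {a : ℝ → ℝ} (ha : Continuous a) {H H' : ℝ → ℝ → ℝ}
    (hH : Continuous fun p : ℝ × ℝ => H p.1 p.2) (hH' : Continuous fun p : ℝ × ℝ => H' p.1 p.2)
    (hd : ∀ s v, HasDerivAt (fun s => H s v) (H' s v) s) (s₀ : ℝ)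
    (hs : ∃ P : ℝ, ∀ᶠ s in nhds s₀, ∀ v, P < |v| → H s v = 0) :
    HasDerivAt (fun s => ∫ v, a v * H s v) (∫ v, a v * H' s₀ v) s₀ := by
  obtain ⟨P, hP⟩ := hs
  have h1 := hasDerivAt_param_integral (H := fun v s => a v * H s v) (H' := fun v s => a v * H' s v)
    ((ha.comp continuous_fst).mul (hH.comp continuous_swap))
    ((ha.comp continuous_fst).mul (hH'.comp continuous_swap))
    (fun v s => (hd s v).const_mul (a v)) (-|P|) |P| s₀
  have h2 : ∫ v, a v * H' s₀ v = ∫ v in (-|P|)..|P|, a v * H' s₀ v := by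
    refine integral_eq_interval (abs_nonneg P) fun v hv => ?_
    have : HasDerivAt (fun s => H s v) 0 s₀ := by
      refine (hasDerivAt_const s₀ (0:ℝ)).congr_of_eventuallyEq ?_
      filter_upwards [hP] with s hs
      exact hs v (lt_of_le_of_lt (le_abs_self P) hv)
    rw [(hd s₀ v).unique this, mul_zero]
  rw [h2]
  refine h1.congr_of_eventuallyEq ?_
  filter_upwards [hP] with s hs
  refine (integral_eq_interval (abs_nonneg P) fun v hv => ?_)
  rw [hs v (lt_of_le_of_lt (le_abs_self P) hv), mul_zero]

theorem mom_bound {a h : ℝ → ℝ} {P C m : ℝ} (hP : 0 ≤ P) (hC : 0 ≤ C)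
    (ha : ∀ v, |v| ≤ P → |a v| ≤ C) (hm : ∀ v, |h v| ≤ m) (hz : ∀ v, P < |v| → h v = 0) :
    |∫ v, a v * h v| ≤ 2 * P * (C * m) := by
  rw [integral_eq_interval hP (fun v hv => by rw [hz v hv, mul_zero])]
  have := intervalIntegral.norm_integral_le_of_norm_le_const (a := -P) (b := P)
    (f := fun v => a v * h v) (C := C * m) (fun v hv => by
      rw [uIoc_of_le (by linarith)] at hv
      rw [Real.norm_eq_abs, abs_mul]
      have := ha v (abs_le.2 ⟨hv.1.le, hv.2⟩)
      have := hm v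
      gcongr)
  rw [Real.norm_eq_abs] at this
  refine this.trans (le_of_eq ?_)
  rw [abs_of_nonneg (by linarith)]; ring

theorem mom_by_parts {a a' h h' : ℝ → ℝ} (ha : ∀ v, HasDerivAt a (a' v) v) (ha' : Continuous a')
    (hh : ∀ v, HasDerivAt h (h' v) v) (hh' : Continuous h') {P : ℝ}
    (hz : ∀ v, P < |v| → h v = 0) :
    ∫ v, a v * h' v = - ∫ v, a' v * h v := by
  have hz' : ∀ v, |P| + 1 < |v| → h' v = 0 := by
    intro v hv
    have hPa := le_abs_self P
    have : HasDerivAt h 0 v := by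
      refine (hasDerivAt_const v (0:ℝ)).congr_of_eventuallyEq ?_
      have : ∀ᶠ w in nhds v, P < |w| :=
        (continuous_abs.tendsto v).eventually (lt_mem_nhds (by linarith))
      filter_upwards [this] with w hw using hz w hw
    exact (hh v).unique this
  have hp : 0 ≤ |P| + 1 := by positivity
  have hca : Continuous a := continuous_iff_continuousAt.2 fun v => (ha v).continuousAt
  have hch : Continuous h := continuous_iff_continuousAt.2 fun v => (hh v).continuousAt
  have hPa := le_abs_self P
  rw [integral_eq_interval hp (fun v hv => by rw [hz' v hv, mul_zero]),
    integral_eq_interval hp (fun v hv => by rw [hz v (by linarith), mul_zero]),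
    intervalIntegral.integral_mul_deriv_eq_deriv_mul (fun v _ => ha v) (fun v _ => hh v)
      (ha'.intervalIntegrable _ _) (hh'.intervalIntegrable _ _),
    hz (|P| + 1) (by rw [abs_of_nonneg hp]; linarith),
    hz (-(|P| + 1)) (by rw [abs_neg, abs_of_nonneg hp]; linarith)]
  ring

theorem sq_pos' (v : ℝ) : 0 < 1 + v ^ 2 := by positivity

theorem vhat_contDiff : ContDiff ℝ 1 vhat := by
  unfold vhat
  refine contDiff_id.div ?_ (fun v => (Real.sqrt_pos.2 (sq_pos' v)).ne')
  exact ContDiff.sqrt (by fun_prop) (fun v => (sq_pos' v).ne')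

theorem vhat_abs_lt (v : ℝ) : |vhat v| < 1 := by
  unfold vhat
  rw [abs_div, abs_of_pos (Real.sqrt_pos.2 (sq_pos' v)), div_lt_one (Real.sqrt_pos.2 (sq_pos' v))]
  apply Real.lt_sqrt_of_sq_lt
  rw [sq_abs]; linarith

theorem vhat_deriv_le (v : ℝ) : |deriv vhat v| ≤ 1 := by
  have hp := sq_pos' v
  have hs := Real.sqrt_pos.2 hp
  have hss : Real.sqrt (1 + v ^ 2) ^ 2 = 1 + v ^ 2 := Real.sq_sqrt hp.le
  have h1 : HasDerivAt (fun v : ℝ => 1 + v ^ 2) (2 * v) v := by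
    simpa using (hasDerivAt_pow 2 v).const_add 1
  have h2 := (hasDerivAt_id v).div (h1.sqrt hp.ne') hs.ne'
  have h3 : deriv vhat v = (1 / Real.sqrt (1 + v ^ 2)) ^ 3 := by
    have : HasDerivAt vhat _ v := h2
    rw [this.deriv]
    simp only [id]
    field_simp
    rw [hss]; ring
  rw [h3, abs_of_nonneg (by positivity)]
  apply pow_le_one₀ (by positivity)
  rw [div_le_one hs]
  apply Real.le_sqrt_of_sq_le
  nlinarith [sq_nonneg v]

/-- the Glassey–Strauss type kernel. -/
noncomputable def asig (σ v : ℝ) : ℝ := vhat v / (vhat v + σ)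

theorem vhat_add_ne {σ : ℝ} (hσ : |σ| = 1) (v : ℝ) : vhat v + σ ≠ 0 := by
  intro h
  have h1 := vhat_abs_lt v
  have : vhat v = -σ := by linarith
  rw [this, abs_neg, hσ] at h1
  exact lt_irrefl _ h1

theorem asig_contDiff {σ : ℝ} (hσ : |σ| = 1) : ContDiff ℝ 1 (asig σ) := by
  unfold asig
  exact vhat_contDiff.div (vhat_contDiff.add contDiff_const) (vhat_add_ne hσ)

section flow
variable {V : Type*} [NormedAddCommGroup V] [NormedSpace ℝ V]

theorem gronwallBound_le {δ K ε x : ℝ} (hK : 0 ≤ K) (hε : 0 ≤ ε) (hx : 0 ≤ x) :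
    gronwallBound δ K ε x ≤ (δ + ε * x) * Real.exp (K * x) ∨ δ < 0 := by
  rcases lt_or_ge δ 0 with h | hδ
  · exact Or.inr h
  left
  rcases hK.eq_or_lt with h | h
  · rw [← h, gronwallBound_K0]; simp
  · rw [gronwallBound_of_K_ne_0 h.ne']
    have h1 := Real.add_one_le_exp (-(K * x))
    have h2 := Real.exp_pos (K * x)
    have h3 : Real.exp (-(K * x)) * Real.exp (K * x) = 1 := by rw [← Real.exp_add]; simp
    have h4 : Real.exp (K * x) - 1 ≤ K * x * Real.exp (K * x) := by nlinarith
    have h5 : ε / K * (Real.exp (K * x) - 1) ≤ ε / K * (K * x * Real.exp (K * x)) := by gcongr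
    have h6 : ε / K * (K * x * Real.exp (K * x)) = ε * x * Real.exp (K * x) := by field_simp
    simp only
    nlinarith

/-- two-sided Gronwall estimate. -/
theorem gronwall_two {u u' : ℝ → V} {K ε a b : ℝ} (hK : 0 ≤ K) (hε : 0 ≤ ε)
    (hu : ∀ s ∈ uIcc a b, HasDerivAt u (u' s) s)
    (hb : ∀ s ∈ uIcc a b, ‖u' s‖ ≤ K * ‖u s‖ + ε) :
    ‖u b‖ ≤ (‖u a‖ + ε * |b - a|) * Real.exp (K * |b - a|) := by
  have hmem : ∀ τ ∈ Icc (0:ℝ) 1, a + (b - a) * τ ∈ uIcc a b := by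
    intro τ hτ
    rcases le_total a b with h | h
    · rw [uIcc_of_le h]; constructor <;> nlinarith [hτ.1, hτ.2]
    · rw [uIcc_of_ge h]; constructor <;> nlinarith [hτ.1, hτ.2]
  have hd : ∀ τ ∈ Icc (0:ℝ) 1, HasDerivAt (fun τ => u (a + (b - a) * τ))
      ((b - a) • u' (a + (b - a) * τ)) τ := by
    intro τ hτ
    have h1 : HasDerivAt (fun τ : ℝ => a + (b - a) * τ) (b - a) τ := by
      simpa using ((hasDerivAt_id τ).const_mul (b - a)).const_add a
    exact (hu _ (hmem τ hτ)).scomp τ h1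
  have h := norm_le_gronwallBound_of_norm_deriv_right_le (f := fun τ => u (a + (b - a) * τ))
    (f' := fun τ => (b - a) • u' (a + (b - a) * τ)) (δ := ‖u a‖) (K := K * |b - a|)
    (ε := ε * |b - a|) (a := 0) (b := 1)
    (fun τ hτ => (hd τ hτ).continuousAt.continuousWithinAt)
    (fun τ hτ => (hd τ (Ico_subset_Icc_self hτ)).hasDerivWithinAt) (by simp)
    (fun τ hτ => by
      rw [norm_smul, Real.norm_eq_abs]
      have := hb _ (hmem τ (Ico_subset_Icc_self hτ))
      nlinarith [abs_nonneg (b - a)]) 1 (by simp)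
  rcases gronwallBound_le (δ := ‖u a‖) (K := K * |b - a|) (ε := ε * |b - a|) (x := 1)
    (by positivity) (by positivity) zero_le_one with h2 | h2
  · simp only [mul_one, sub_zero, add_sub_cancel] at h h2
    exact h.trans h2
  · exact absurd h2 (not_lt.2 (norm_nonneg _))

/-- solution of the characteristic ODE on a symmetric interval -/
def IsSol (F : ℝ → V → V) (N : ℝ) (γ : ℝ → V) : Prop :=
  ∀ s ∈ Ioo (-N) N, HasDerivAt γ (F s (γ s)) s

/-- assumptions on the vector field -/
structure GoodField (F : ℝ → V → V) (F' : ℝ → V → V →L[ℝ] V) : Prop where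
  cont : Continuous fun p : ℝ × V => F p.1 p.2
  cont' : Continuous fun p : ℝ × V => F' p.1 p.2
  deriv : ∀ t z, HasFDerivAt (F t) (F' t z) z
  bound : ∀ T : ℝ, ∃ K : ℝ, 0 ≤ K ∧ ∀ t, |t| ≤ T → ∀ z, ‖F t z‖ ≤ K ∧ ‖F' t z‖ ≤ K

variable {F : ℝ → V → V} {F' : ℝ → V → V →L[ℝ] V}

theorem GoodField.lip (h : GoodField F F') {t K : ℝ} (hK : ∀ z, ‖F' t z‖ ≤ K) (z w : V) :
    ‖F t z - F t w‖ ≤ K * ‖z - w‖ :=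
  Convex.norm_image_sub_le_of_norm_hasFDerivWithin_le (s := univ) (f := F t) (f' := F' t)
    (fun x _ => (h.deriv t x).hasFDerivWithinAt) (fun x _ => hK x) convex_univ trivial trivial

theorem GoodField.exists_sol [CompleteSpace V] (h : GoodField F F') {N t₀ : ℝ}
    (ht : t₀ ∈ Ioo (-N) N) (z₀ : V) : ∃ γ : ℝ → V, γ t₀ = z₀ ∧ IsSol F N γ := by
  obtain ⟨K, hK0, hK⟩ := h.bound N
  have hN : 0 < N := by linarith [ht.1, ht.2]
  have hab : ∀ t ∈ Icc (-N) N, |t| ≤ N := fun t ht => abs_le.2 ht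
  have hPL : IsPicardLindelof F (tmin := -N) (tmax := N) ⟨t₀, Ioo_subset_Icc_self ht⟩ z₀
      (Real.toNNReal (K * (2 * N))) 0 (Real.toNNReal K) (Real.toNNReal K) := by
    refine ⟨?_, ?_, ?_, ?_⟩
    · intro t ht
      refine LipschitzWith.lipschitzOnWith (LipschitzWith.of_dist_le_mul fun x y => ?_)
      rw [dist_eq_norm, dist_eq_norm, Real.coe_toNNReal _ hK0]
      exact h.lip (fun z => (hK t (hab t ht) z).2) x y
    · intro x _
      exact (h.cont.comp (f := fun t : ℝ => (t, x)) (by fun_prop)).continuousOn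
    · intro t ht x _
      rw [Real.coe_toNNReal _ hK0]
      exact (hK t (hab t ht) x).1
    · rw [Real.coe_toNNReal _ hK0, Real.coe_toNNReal _ (by positivity)]
      simp only [NNReal.coe_zero, sub_zero]
      gcongr
      exact max_le (by linarith [ht.1]) (by linarith [ht.2])
  obtain ⟨γ, h1, h2⟩ := hPL.exists_eq_forall_mem_Icc_hasDerivWithinAt₀
  exact ⟨γ, h1, fun s hs => (h2 s (Ioo_subset_Icc_self hs)).hasDerivAt (Icc_mem_nhds hs.1 hs.2)⟩

theorem uIcc_sub_Ioo {N a b s : ℝ} (ha : a ∈ Ioo (-N) N) (hb : b ∈ Ioo (-N) N)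
    (hs : s ∈ uIcc a b) : s ∈ Ioo (-N) N := by
  rcases le_total a b with h | h
  · rw [uIcc_of_le h] at hs; exact ⟨ha.1.trans_le hs.1, hs.2.trans_lt hb.2⟩
  · rw [uIcc_of_ge h] at hs; exact ⟨hb.1.trans_le hs.1, hs.2.trans_lt ha.2⟩

/-- Lipschitz dependence -/
theorem GoodField.dist_sol (h : GoodField F F') {N K : ℝ} (hK0 : 0 ≤ K)
    (hK : ∀ t, |t| ≤ N → ∀ z, ‖F' t z‖ ≤ K) {γ γ' : ℝ → V} (hγ : IsSol F N γ) (hγ' : IsSol F N γ')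
    {a b : ℝ} (ha : a ∈ Ioo (-N) N) (hb : b ∈ Ioo (-N) N) :
    ‖γ b - γ' b‖ ≤ ‖γ a - γ' a‖ * Real.exp (K * |b - a|) := by
  have := gronwall_two (u := fun s => γ s - γ' s) (u' := fun s => F s (γ s) - F s (γ' s))
    (a := a) (b := b) hK0 le_rfl
    (fun s hs => (hγ s (uIcc_sub_Ioo ha hb hs)).sub (hγ' s (uIcc_sub_Ioo ha hb hs)))
    (fun s hs => by
      have hs := uIcc_sub_Ioo ha hb hs
      simpa using h.lip (fun z => hK s (abs_le.2 ⟨hs.1.le, hs.2.le⟩) z) (γ s) (γ' s))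
  simpa using this

theorem GoodField.sol_unique (h : GoodField F F') {N : ℝ}
    {γ γ' : ℝ → V} (hγ : IsSol F N γ) (hγ' : IsSol F N γ')
    {a b : ℝ} (ha : a ∈ Ioo (-N) N) (hb : b ∈ Ioo (-N) N) (he : γ a = γ' a) : γ b = γ' b := by
  obtain ⟨K, hK0, hK⟩ := h.bound N
  have := h.dist_sol hK0 (fun t ht z => (hK t ht z).2) hγ hγ' ha hb
  rw [he, sub_self, norm_zero, zero_mul] at this
  exact sub_eq_zero.1 (norm_le_zero_iff.1 this)

theorem IsSol.mono {N M : ℝ} (hM : M ≤ N) {γ : ℝ → V} (h : IsSol F N γ) : IsSol F M γ :=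
  fun s hs => h s ⟨by linarith [hs.1], by linarith [hs.2]⟩

theorem mem_Ioo_abs (t : ℝ) : t ∈ Ioo (-(|t| + 1)) (|t| + 1) := by
  constructor <;> linarith [neg_abs_le t, le_abs_self t]

theorem mem_Ioo_of_abs {t N : ℝ} (h : |t| < N) : t ∈ Ioo (-N) N := abs_lt.1 h

open Classical in
/-- the position at time 0 of the characteristic through (t,z) -/
noncomputable def YY (F : ℝ → V → V) (t : ℝ) (z : V) : V :=
  if h : ∃ γ : ℝ → V, γ t = z ∧ IsSol F (|t| + 1) γ then h.choose 0 else z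

theorem GoodField.YY_spec [CompleteSpace V] (h : GoodField F F') {N : ℝ} {γ : ℝ → V}
    (hγ : IsSol F N γ) {t : ℝ} (ht : t ∈ Ioo (-N) N) : YY F t (γ t) = γ 0 := by
  have hex := h.exists_sol (mem_Ioo_abs t) (γ t)
  unfold YY
  rw [dif_pos hex]
  obtain ⟨h1, h2⟩ := hex.choose_spec
  have hN : 0 < N := by linarith [ht.1, ht.2]
  have hm : 0 < min N (|t| + 1) := lt_min hN (by positivity)
  have htt := mem_Ioo_abs t
  refine h.sol_unique (h2.mono (min_le_right N _)) (hγ.mono (min_le_left _ (|t| + 1))) (a := t)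
    ?_ ⟨by linarith, hm⟩ h1
  apply mem_Ioo_of_abs
  exact lt_min (abs_lt.2 ht) (by linarith)

theorem GoodField.YY_lip [CompleteSpace V] (h : GoodField F F') {T K : ℝ} (hK0 : 0 ≤ K)
    (hK : ∀ t, |t| ≤ T + 1 → ∀ z, ‖F' t z‖ ≤ K) {t : ℝ} (ht : |t| ≤ T) (z z' : V) :
    ‖YY F t z - YY F t z'‖ ≤ ‖z - z'‖ * Real.exp (K * T) := by
  have hT : 0 ≤ T := (abs_nonneg t).trans ht
  have ht' : t ∈ Ioo (-(T + 1)) (T + 1) := mem_Ioo_of_abs (by linarith)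
  have h0 : (0:ℝ) ∈ Ioo (-(T + 1)) (T + 1) := ⟨by linarith, by linarith⟩
  obtain ⟨γ, h1, h2⟩ := h.exists_sol ht' z
  obtain ⟨γ', h1', h2'⟩ := h.exists_sol ht' z'
  rw [← h1, ← h1', h.YY_spec h2 ht', h.YY_spec h2' ht']
  refine (h.dist_sol hK0 hK h2 h2' ht' h0).trans ?_
  rw [zero_sub, abs_neg]
  gcongr

theorem GoodField.YY_cont [CompleteSpace V] (h : GoodField F F') :
    Continuous fun p : ℝ × V => YY F p.1 p.2 := by
  rw [continuous_iff_continuousAt]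
  rintro ⟨t₀, z₀⟩
  obtain ⟨K, hK0, hK⟩ := h.bound (|t₀| + 2)
  obtain ⟨γ, h1, h2⟩ := h.exists_sol (mem_Ioo_abs t₀) z₀
  have h3 : ∀ᶠ p : ℝ × V in nhds (t₀, z₀), ‖YY F p.1 p.2 - YY F t₀ z₀‖ ≤
      (‖p.2 - γ p.1‖) * Real.exp (K * (|t₀| + 1)) := by
    have : ∀ᶠ p : ℝ × V in nhds (t₀, z₀), p.1 ∈ Ioo (-(|t₀| + 1)) (|t₀| + 1) :=
      continuousAt_fst.eventually (Ioo_mem_nhds (mem_Ioo_abs t₀).1 (mem_Ioo_abs t₀).2)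
    filter_upwards [this] with p hp
    have h4 := h.YY_spec h2 hp
    have h5 := h.YY_spec h2 (mem_Ioo_abs t₀)
    rw [h1] at h5
    rw [h5, ← h4]
    exact h.YY_lip hK0 (fun t ht z => (hK t (by linarith) z).2) (abs_lt.2 hp).le _ _
  have hc : ContinuousAt γ t₀ := (h2 t₀ (mem_Ioo_abs t₀)).continuousAt
  have h6 : Filter.Tendsto (fun p : ℝ × V => (‖p.2 - γ p.1‖) * Real.exp (K * (|t₀| + 1)))
      (nhds (t₀, z₀)) (nhds 0) := by
    have : ContinuousAt (fun p : ℝ × V => (‖p.2 - γ p.1‖) * Real.exp (K * (|t₀| + 1)))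
        (t₀, z₀) := by
      have : ContinuousAt (fun p : ℝ × V => γ p.1) (t₀, z₀) :=
        ContinuousAt.comp (f := fun p : ℝ × V => p.1) (x := (t₀, z₀)) hc continuousAt_fst
      fun_prop
    simpa [ContinuousAt, h1] using this
  rw [ContinuousAt, tendsto_iff_norm_sub_tendsto_zero]
  exact squeeze_zero' (Filter.Eventually.of_forall fun _ => norm_nonneg _) h3 h6

end flow

theorem lim_of_unifCauchy {ι X W : Type*} {p : Filter ι} [p.NeBot] [PseudoMetricSpace X] {x₀ : X}
    [NormedAddCommGroup W] [CompleteSpace W] {Q : ι → X → W} (hc : ∀ᶠ i in p, Continuous (Q i))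
    (hcs : ∀ R : ℝ, UniformCauchySeqOn Q p (Metric.closedBall x₀ R)) :
    ∃ M : X → W, Continuous M ∧ ∀ R : ℝ, TendstoUniformlyOn Q M p (Metric.closedBall x₀ R) := by
  have hex : ∀ x, ∃ y, Filter.Tendsto (fun i => Q i x) p (nhds y) := fun x =>
    cauchy_map_iff_exists_tendsto.1 ((hcs (dist x x₀)).cauchy_map (x := x) (by simp))
  choose M hM using hex
  have hu : ∀ R : ℝ, TendstoUniformlyOn Q M p (Metric.closedBall x₀ R) := fun R =>
    (hcs R).tendstoUniformlyOn_of_tendsto fun x _ => hM x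
  refine ⟨M, ?_, hu⟩
  have hl : TendstoLocallyUniformly Q M p := by
    intro u hu' x
    refine ⟨Metric.closedBall x₀ (dist x x₀ + 1), ?_, hu _ u hu'⟩
    refine Filter.mem_of_superset (Metric.ball_mem_nhds x one_pos) fun y hy => ?_
    rw [Metric.mem_ball] at hy
    rw [Metric.mem_closedBall]
    linarith [dist_triangle y x x₀]
  exact hl.continuous hc.frequently

section flow2
variable {V : Type*} [NormedAddCommGroup V] [NormedSpace ℝ V] [CompleteSpace V] [ProperSpace V]
variable {F : ℝ → V → V} {F' : ℝ → V → V →L[ℝ] V}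

/-- uniform first order Taylor expansion of the field on compact sets -/
theorem GoodField.taylor (h : GoodField F F') (R ρ : ℝ) {ε : ℝ} (hε : 0 < ε) :
    ∃ δ > 0, ∀ s, |s| ≤ R → ∀ z, ‖z‖ ≤ ρ → ∀ w, ‖w‖ ≤ δ →
      ‖F s (z + w) - F s z - F' s z w‖ ≤ ε * ‖w‖ := by
  have hcomp : IsCompact (Icc (-R) R ×ˢ Metric.closedBall (0:V) (ρ + 1)) :=
    isCompact_Icc.prod (isCompact_closedBall _ _)
  have huc := hcomp.uniformContinuousOn_of_continuous h.cont'.continuousOn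
  obtain ⟨δ, hδ, hd⟩ := Metric.uniformContinuousOn_iff.1 huc ε hε
  refine ⟨min (δ / 2) 1, by positivity, fun s hs z hz w hw => ?_⟩
  have hw1 : ‖w‖ ≤ 1 := hw.trans (min_le_right _ _)
  have hw2 : ‖w‖ ≤ δ / 2 := hw.trans (min_le_left _ _)
  have := Convex.norm_image_sub_le_of_norm_hasFDerivWithin_le' (𝕜 := ℝ) (f := F s) (f' := F' s)
    (φ := F' s z) (s := Metric.closedBall z ‖w‖) (C := ε) (x := z) (y := z + w)
    (fun x _ => (h.deriv s x).hasFDerivWithinAt) (fun x hx => ?_) (convex_closedBall _ _)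
    (by simp) (by simp)
  · simpa using this
  · rw [Metric.mem_closedBall] at hx
    have hx' : ‖x‖ ≤ ρ + 1 := by
      have := norm_le_norm_add_norm_sub' x z
      rw [dist_eq_norm] at hx; linarith
    have := hd (s, x) ⟨abs_le.1 hs, by simpa using hx'⟩ (s, z)
      ⟨abs_le.1 hs, by simp; linarith⟩ (by
        rw [Prod.dist_eq]; simp [hδ]; linarith)
    rw [dist_eq_norm] at this
    exact this.le

/-- displacement bound -/
theorem GoodField.sol_disp {N K : ℝ} (hK : ∀ t, |t| ≤ N → ∀ z, ‖F t z‖ ≤ K)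
    {γ : ℝ → V} (hγ : IsSol F N γ) {a b : ℝ} (ha : a ∈ Ioo (-N) N) (hb : b ∈ Ioo (-N) N) :
    ‖γ b - γ a‖ ≤ K * |b - a| := by
  have := Convex.norm_image_sub_le_of_norm_hasDerivWithin_le (f := γ)
    (f' := fun s => F s (γ s)) (s := Ioo (-N) N) (C := K)
    (fun s hs => (hγ s hs).hasDerivWithinAt)
    (fun s hs => hK s (abs_lt.2 hs).le _) (convex_Ioo _ _) ha hb
  simpa using this

theorem GoodField.quot_cauchy (h : GoodField F F') (e : V) (R : ℝ) {η : ℝ} (hη : 0 < η) :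
    ∃ δ > 0, ∀ t, |t| ≤ R → ∀ z, ‖z‖ ≤ R → ∀ a b : ℝ, a ≠ 0 → b ≠ 0 → |a| < δ → |b| < δ →
      ‖a⁻¹ • (YY F t (z + a • e) - YY F t z) - b⁻¹ • (YY F t (z + b • e) - YY F t z)‖ < η := by
  rcases lt_or_ge R 0 with hR | hR
  · exact ⟨1, one_pos, fun t ht => absurd (hR.trans_le (abs_nonneg t)) (not_lt.2 ht)⟩
  obtain ⟨K, hK0, hK⟩ := h.bound (R + 1)
  set L := Real.exp (K * R) with hL
  have hLpos : 0 < L := Real.exp_pos _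
  set D := 2 * (L * ‖e‖) * R * L + 1 with hD
  have hDpos : 0 < D := by positivity
  obtain ⟨δ, hδ, hT⟩ := h.taylor R (R + K * R) (ε := η / (2 * D)) (by positivity)
  refine ⟨δ / (L * ‖e‖ + 1), by positivity, fun t ht z hz a b ha hb had hbd => ?_⟩
  have ht' : t ∈ Ioo (-(R + 1)) (R + 1) := mem_Ioo_of_abs (by linarith)
  have h0 : (0:ℝ) ∈ Ioo (-(R + 1)) (R + 1) := ⟨by linarith, by linarith⟩
  obtain ⟨γ, h1, h2⟩ := h.exists_sol ht' z
  have key : ∀ a : ℝ, a ≠ 0 → |a| < δ / (L * ‖e‖ + 1) → ∀ γ' : ℝ → V, γ' t = z + a • e →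
      IsSol F (R + 1) γ' → ∀ s ∈ uIcc t 0,
      ‖a⁻¹ • (F s (γ' s) - F s (γ s)) - F' s (γ s) (a⁻¹ • (γ' s - γ s))‖
        ≤ η / (2 * D) * (L * ‖e‖) := by
    intro a ha had γ' h1' h2' s hs
    have hs' : s ∈ Ioo (-(R + 1)) (R + 1) := uIcc_sub_Ioo ht' h0 hs
    have hst : |s - t| ≤ R ∧ |s| ≤ R := by
      rcases le_total t 0 with h | h
      · rw [uIcc_of_le h] at hs
        rw [abs_le] at ht
        constructor <;> rw [abs_le] <;> constructor <;> linarith [hs.1, hs.2, ht.1]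
      · rw [uIcc_of_ge h] at hs
        rw [abs_le] at ht
        constructor <;> rw [abs_le] <;> constructor <;> linarith [hs.1, hs.2, ht.2]
    have hdist : ‖γ' s - γ s‖ ≤ |a| * (L * ‖e‖) := by
      have := h.dist_sol hK0 (fun t ht z => (hK t ht z).2) h2' h2 ht' hs'
      rw [h1', h1, add_sub_cancel_left, norm_smul, Real.norm_eq_abs] at this
      refine this.trans ?_
      have : Real.exp (K * |s - t|) ≤ L := by rw [hL]; gcongr; exact hst.1
      calc |a| * ‖e‖ * Real.exp (K * |s - t|) ≤ |a| * ‖e‖ * L := by gcongr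
        _ = _ := by ring
    have hγs : ‖γ s‖ ≤ R + K * R := by
      have := GoodField.sol_disp (fun t ht z => (hK t ht z).1) h2 ht' hs'
      rw [h1] at this
      have h3 : K * |s - t| ≤ K * R := by gcongr; exact hst.1
      have := norm_le_norm_add_norm_sub' (γ s) z
      linarith
    have hsm : ‖γ' s - γ s‖ ≤ δ := by
      refine hdist.trans ?_
      have : |a| * (L * ‖e‖ + 1) < δ := (lt_div_iff₀ (by positivity)).1 had
      nlinarith [abs_nonneg a]
    have hTs := hT s hst.2 (γ s) hγs (γ' s - γ s) hsm
    rw [add_sub_cancel] at hTs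
    rw [map_smul, ← smul_sub, norm_smul, norm_inv, Real.norm_eq_abs]
    have hapos : 0 < |a| := abs_pos.2 ha
    rw [inv_mul_le_iff₀ hapos]
    refine hTs.trans ?_
    calc η / (2 * D) * ‖γ' s - γ s‖ ≤ η / (2 * D) * (|a| * (L * ‖e‖)) := by gcongr
      _ = _ := by ring
  obtain ⟨γ₁, h11, h12⟩ := h.exists_sol ht' (z + a • e)
  obtain ⟨γ₂, h21, h22⟩ := h.exists_sol ht' (z + b • e)
  have e0 := h.YY_spec h2 ht'
  have e1 := h.YY_spec h12 ht'
  have e2 := h.YY_spec h22 ht'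
  rw [h1] at e0; rw [h11] at e1; rw [h21] at e2
  rw [e0, e1, e2]
  have hg := gronwall_two (K := K) (ε := 2 * (η / (2 * D) * (L * ‖e‖)))
    (u := fun s => a⁻¹ • (γ₁ s - γ s) - b⁻¹ • (γ₂ s - γ s))
    (u' := fun s => a⁻¹ • (F s (γ₁ s) - F s (γ s)) - b⁻¹ • (F s (γ₂ s) - F s (γ s)))
    (a := t) (b := 0) hK0 (by positivity)
    (fun s hs => by
      have hs' := uIcc_sub_Ioo ht' h0 hs
      exact (((h12 s hs').sub (h2 s hs')).const_smul _).sub (((h22 s hs').sub (h2 s hs')).const_smul _))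
    (fun s hs => by
      have hs' := uIcc_sub_Ioo ht' h0 hs
      have k1 := key a ha had γ₁ h11 h12 s hs
      have k2 := key b hb hbd γ₂ h21 h22 s hs
      have k3 : ‖F' s (γ s) (a⁻¹ • (γ₁ s - γ s) - b⁻¹ • (γ₂ s - γ s))‖ ≤
          K * ‖a⁻¹ • (γ₁ s - γ s) - b⁻¹ • (γ₂ s - γ s)‖ :=
        ContinuousLinearMap.le_of_opNorm_le _ (hK s (abs_lt.2 hs').le _).2 _
      rw [map_sub] at k3
      set A := a⁻¹ • (F s (γ₁ s) - F s (γ s))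
      set B := b⁻¹ • (F s (γ₂ s) - F s (γ s))
      set A' := F' s (γ s) (a⁻¹ • (γ₁ s - γ s))
      set B' := F' s (γ s) (b⁻¹ • (γ₂ s - γ s))
      have : A - B = (A' - B') + ((A - A') - (B - B')) := by abel
      rw [this]
      have n1 := norm_add_le (A' - B') ((A - A') - (B - B'))
      have n2 := norm_sub_le (A - A') (B - B')
      linarith)
  have hu : a⁻¹ • (γ₁ t - γ t) - b⁻¹ • (γ₂ t - γ t) = 0 := by
    rw [h11, h1, h21, add_sub_cancel_left, add_sub_cancel_left, smul_smul, smul_smul,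
      inv_mul_cancel₀ ha, inv_mul_cancel₀ hb, sub_self]
  simp only [hu, norm_zero, zero_add, zero_sub, abs_neg] at hg
  refine lt_of_le_of_lt hg ?_
  have hexp : Real.exp (K * |t|) ≤ L := by rw [hL]; gcongr
  calc 2 * (η / (2 * D) * (L * ‖e‖)) * |t| * Real.exp (K * |t|)
      ≤ 2 * (η / (2 * D) * (L * ‖e‖)) * R * L := by gcongr
    _ = η / 2 * ((D - 1) / D) := by rw [hD]; field_simp; ring
    _ < η := by
      have : (D - 1) / D ≤ 1 := by rw [div_le_one hDpos]; linarith
      nlinarith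

/-- directional derivatives of the flow exist and are continuous. -/
theorem GoodField.exists_dir (h : GoodField F F') (e : V) :
    ∃ M : ℝ → V → V, (Continuous fun p : ℝ × V => M p.1 p.2) ∧
      ∀ t z, HasDerivAt (fun a : ℝ => YY F t (z + a • e)) (M t z) 0 := by
  set Q : ℝ → ℝ × V → V := fun a p => a⁻¹ • (YY F p.1 (p.2 + a • e) - YY F p.1 p.2) with hQ
  obtain ⟨M, hM, hlim⟩ := lim_of_unifCauchy (x₀ := (0 : ℝ × V)) (Q := Q) (p := nhdsWithin 0 {0}ᶜ)
    (Filter.Eventually.of_forall fun a => by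
      have := h.YY_cont
      have h2 : Continuous fun p : ℝ × V => YY F p.1 (p.2 + a • e) :=
        this.comp (f := fun p : ℝ × V => (p.1, p.2 + a • e)) (by fun_prop)
      exact (h2.sub this).const_smul _)
    (fun R u hu => by
      obtain ⟨η, hη, hu'⟩ := Metric.mem_uniformity_dist.1 hu
      obtain ⟨δ, hδ, hd⟩ := h.quot_cauchy e R hη
      have hev : ∀ᶠ a : ℝ in nhdsWithin 0 {0}ᶜ, a ≠ 0 ∧ |a| < δ := by
        refine (eventually_mem_nhdsWithin.and (nhdsWithin_le_nhds (Metric.ball_mem_nhds 0 hδ))).mono ?_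
        rintro a ⟨h1, h2⟩
        exact ⟨h1, by simpa using h2⟩
      filter_upwards [hev.prod_mk hev] with m hm p hp
      apply hu'
      rw [dist_eq_norm]
      have hp' : ‖p‖ ≤ R := by simpa using hp
      exact hd p.1 ((norm_fst_le p).trans hp') p.2 ((norm_snd_le p).trans hp') _ _ hm.1.1 hm.2.1
        hm.1.2 hm.2.2)
  refine ⟨fun t z => M (t, z), hM, fun t z => ?_⟩
  rw [hasDerivAt_iff_tendsto_slope_zero]
  have := (hlim ‖(t, z)‖).tendsto_at (x := (t, z)) (by simp)
  simpa [hQ] using this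
end flow2

section flow3
variable {F : ℝ → ℝ × ℝ → ℝ × ℝ} {F' : ℝ → ℝ × ℝ → ℝ × ℝ →L[ℝ] ℝ × ℝ}

theorem GoodField.exists_M (h : GoodField F F') :
    ∃ M : ℝ → ℝ × ℝ → ℝ × ℝ →L[ℝ] ℝ × ℝ, (Continuous fun p : ℝ × ℝ × ℝ => M p.1 p.2) ∧
      ∀ t z, HasFDerivAt (YY F t) (M t z) z := by
  obtain ⟨M1, c1, d1⟩ := h.exists_dir ((1:ℝ), (0:ℝ))
  obtain ⟨M2, c2, d2⟩ := h.exists_dir ((0:ℝ), (1:ℝ))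
  refine ⟨fun t z => (ContinuousLinearMap.fst ℝ ℝ ℝ).smulRight (M1 t z) +
        (ContinuousLinearMap.snd ℝ ℝ ℝ).smulRight (M2 t z), by fun_prop, fun t z => ?_⟩
  refine hasFDerivAt_partials (g := fun x v => YY F t (x, v)) (g1 := fun x v => M1 t (x, v))
    (g2 := fun x v => M2 t (x, v)) ?_ ?_ ?_ ?_ z
  · intro x y
    have h1 := d1 t (x, y)
    rw [← sub_self x] at h1
    have := h1.comp_sub_const x x
    simpa using this
  · intro x y
    have h1 := d2 t (x, y)
    rw [← sub_self y] at h1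
    have := h1.comp_sub_const y y
    simpa using this
  · exact c1.comp (f := fun p : ℝ × ℝ => (t, p)) (by fun_prop)
  · exact c2.comp (f := fun p : ℝ × ℝ => (t, p)) (by fun_prop)

theorem GoodField.time_deriv (h : GoodField F F') {M : ℝ → ℝ × ℝ → ℝ × ℝ →L[ℝ] ℝ × ℝ}
    (hM : Continuous fun p : ℝ × ℝ × ℝ => M p.1 p.2)
    (hd : ∀ t z, HasFDerivAt (YY F t) (M t z) z) (t₀ : ℝ) (z₀ : ℝ × ℝ) :
    HasDerivAt (fun t => YY F t z₀) (-(M t₀ z₀ (F t₀ z₀))) t₀ := by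
  obtain ⟨γ, h1, h2⟩ := h.exists_sol (mem_Ioo_abs t₀) z₀
  have hγ := h2 t₀ (mem_Ioo_abs t₀)
  rw [h1] at hγ
  have hev : ∀ᶠ t in nhds t₀, t ∈ Ioo (-(|t₀| + 1)) (|t₀| + 1) :=
    Ioo_mem_nhds (mem_Ioo_abs t₀).1 (mem_Ioo_abs t₀).2
  have hO : (fun t => YY F t (γ t) - YY F t z₀ - M t₀ z₀ (γ t - z₀)) =o[nhds t₀]
      (fun t => γ t - z₀) := by
    rw [Asymptotics.isLittleO_iff]
    intro c hc
    obtain ⟨δ, hδ, hMd⟩ := Metric.continuousAt_iff.1 (hM.continuousAt (x := (t₀, z₀))) c hc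
    have e1 : ∀ᶠ t in nhds t₀, dist t t₀ < δ := Metric.ball_mem_nhds t₀ hδ
    have e2 : ∀ᶠ t in nhds t₀, dist (γ t) z₀ < δ := by
      have := hγ.continuousAt
      rw [ContinuousAt, h1] at this
      exact this (Metric.ball_mem_nhds z₀ hδ)
    filter_upwards [e1, e2] with t h3 h4
    refine Convex.norm_image_sub_le_of_norm_hasFDerivWithin_le' (𝕜 := ℝ) (f := YY F t)
      (f' := M t) (s := Metric.ball z₀ δ) (fun x _ => (hd t x).hasFDerivWithinAt) (fun x hx => ?_)
      (convex_ball _ _) (Metric.mem_ball_self hδ) h4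
    have := hMd (x := (t, x)) (by rw [Prod.dist_eq]; exact max_lt h3 hx)
    rw [dist_eq_norm] at this
    exact this.le
  have hγO : (fun t => γ t - z₀) =O[nhds t₀] (fun t => t - t₀) := by
    simpa [h1] using hγ.isBigO_sub
  have hM' : HasDerivAt (fun t => M t₀ z₀ (γ t - z₀)) (M t₀ z₀ (F t₀ z₀)) t₀ :=
    (M t₀ z₀).hasFDerivAt.comp_hasDerivAt t₀ (hγ.sub_const z₀)
  have hR : HasDerivAt (fun t => YY F t (γ t) - YY F t z₀ - M t₀ z₀ (γ t - z₀)) 0 t₀ := by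
    rw [hasDerivAt_iff_isLittleO]
    simpa [h1] using hO.trans_isBigO hγO
  have hS := ((hasDerivAt_const t₀ (γ 0)).sub hM').sub hR
  refine (hS.congr_deriv (by simp)).congr_of_eventuallyEq ?_
  filter_upwards [hev] with t ht
  simp only [Pi.sub_apply, h.YY_spec h2 ht]
  abel

theorem GoodField.YY_fderiv (h : GoodField F F') :
    ∃ M : ℝ → ℝ × ℝ → ℝ × ℝ →L[ℝ] ℝ × ℝ, (Continuous fun p : ℝ × ℝ × ℝ => M p.1 p.2) ∧
      (∀ t z, HasFDerivAt (YY F t) (M t z) z) ∧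
      (∀ t z, HasDerivAt (fun t => YY F t z) (-(M t z (F t z))) t) ∧
      ContDiff ℝ 1 (fun p : ℝ × ℝ × ℝ => YY F p.1 p.2) := by
  obtain ⟨M, cM, dM⟩ := h.exists_M
  have ht := h.time_deriv cM dM
  have hcF := h.cont
  have c1 : Continuous fun p : ℝ × ℝ × ℝ => -(M p.1 p.2 (F p.1 p.2)) := by fun_prop
  refine ⟨M, cM, dM, ht, ?_⟩
  rw [show (1 : WithTop ℕ∞) = ((0:ℕ) : WithTop ℕ∞) + 1 by simp, contDiff_succ_iff_hasFDerivAt]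
  refine ⟨fun p => (ContinuousLinearMap.toSpanSingleton ℝ (-(M p.1 p.2 (F p.1 p.2)))).coprod
    (M p.1 p.2), ?_, fun p => ?_⟩
  · rw [Nat.cast_zero, contDiff_zero]
    have c3 : Continuous fun p : ℝ × ℝ × ℝ =>
        (ContinuousLinearMap.toSpanSingleton ℝ (-(M p.1 p.2 (F p.1 p.2)))) :=
      (ContinuousLinearMap.toSpanSingletonCLE (𝕜 := ℝ) (E := ℝ × ℝ)).continuous.comp c1
    have := (c3.clm_comp (continuous_const (y := ContinuousLinearMap.fst ℝ ℝ (ℝ × ℝ)))).add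
      (cM.clm_comp (continuous_const (y := ContinuousLinearMap.snd ℝ ℝ (ℝ × ℝ))))
    refine this.congr fun p => ?_
    ext <;> simp
  · have c3 : Continuous fun p : ℝ × ℝ × ℝ =>
        (ContinuousLinearMap.toSpanSingleton ℝ (-(M p.1 p.2 (F p.1 p.2)))) :=
      (ContinuousLinearMap.toSpanSingletonCLE (𝕜 := ℝ) (E := ℝ × ℝ)).continuous.comp c1
    exact (hasStrictFDerivAt_uncurry_coprod (𝕜 := ℝ) (u := p) (f := YY F)
      (f₁ := fun t z => ContinuousLinearMap.toSpanSingleton ℝ (-(M t z (F t z))))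
      (f₂ := M)
      (Filter.Eventually.of_forall fun v => (ht v.1 v.2).hasFDerivAt)
      (Filter.Eventually.of_forall fun v => dM v.1 v.2) c3.continuousAt cM.continuousAt).hasFDerivAt
end flow3

/-- assumptions on the electric field -/
structure GoodE (E D : ℝ → ℝ → ℝ) : Prop where
  cont : Continuous fun p : ℝ × ℝ => E p.1 p.2
  cont' : Continuous fun p : ℝ × ℝ => D p.1 p.2
  hasD : ∀ t x, HasDerivAt (E t) (D t x) x
  bound : ∀ T : ℝ, ∃ B : ℝ, 0 ≤ B ∧ ∀ t, |t| ≤ T → ∀ x, |E t x| ≤ B ∧ |D t x| ≤ B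

/-- characteristic field -/
noncomputable def FE (E : ℝ → ℝ → ℝ) (t : ℝ) (z : ℝ × ℝ) : ℝ × ℝ := (vhat z.2, -E t z.1)

/-- its space derivative -/
noncomputable def FE' (D : ℝ → ℝ → ℝ) (t : ℝ) (z : ℝ × ℝ) : ℝ × ℝ →L[ℝ] ℝ × ℝ :=
  (deriv vhat z.2 • ContinuousLinearMap.snd ℝ ℝ ℝ).prod (-(D t z.1) • ContinuousLinearMap.fst ℝ ℝ ℝ)

theorem vhat_hasDerivAt (v : ℝ) : HasDerivAt vhat (deriv vhat v) v :=
  (vhat_contDiff.differentiable (by simp) v).hasDerivAt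

theorem FE_norm_le {E : ℝ → ℝ → ℝ} {t B : ℝ} (hE : ∀ x, |E t x| ≤ B) (z : ℝ × ℝ) :
    ‖FE E t z‖ ≤ 1 + B := by
  have hB : 0 ≤ B := (abs_nonneg _).trans (hE 0)
  rw [FE, Prod.norm_def]
  apply max_le
  · have := (vhat_abs_lt z.2).le
    simp only [Real.norm_eq_abs]; linarith
  · have := hE z.1
    simp only [Real.norm_eq_abs, abs_neg]; linarith

theorem FE'_norm_le {D : ℝ → ℝ → ℝ} {t B : ℝ} (hD : ∀ x, |D t x| ≤ B) (z : ℝ × ℝ) :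
    ‖FE' D t z‖ ≤ 1 + B := by
  have hB : 0 ≤ B := (abs_nonneg _).trans (hD 0)
  refine ContinuousLinearMap.opNorm_le_bound _ (by linarith) fun w => ?_
  have h1 := norm_fst_le w
  have h2 := norm_snd_le w
  have h3 := vhat_deriv_le z.2
  have h4 := hD z.1
  change max _ _ ≤ _
  apply max_le
  · simp only [FE', ContinuousLinearMap.prod_apply, ContinuousLinearMap.smul_apply, ContinuousLinearMap.coe_snd', smul_eq_mul, norm_mul]
    calc |deriv vhat z.2| * ‖w.2‖ ≤ 1 * ‖w‖ := by gcongr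
      _ ≤ (1 + B) * ‖w‖ := by gcongr; linarith
  · simp only [FE', ContinuousLinearMap.prod_apply, ContinuousLinearMap.smul_apply, ContinuousLinearMap.coe_fst', smul_eq_mul, norm_mul,
      norm_neg]
    calc |D t z.1| * ‖w.1‖ ≤ B * ‖w‖ := by gcongr
      _ ≤ (1 + B) * ‖w‖ := by gcongr; linarith

theorem GoodE.field {E D : ℝ → ℝ → ℝ} (h : GoodE E D) : GoodField (FE E) (FE' D) := by
  have hE := h.cont
  have hD := h.cont'
  have hv := vhat_contDiff.continuous
  have hv' := vhat_contDiff.continuous_deriv (by simp)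
  refine ⟨?_, ?_, ?_, ?_⟩
  · unfold FE
    have : Continuous fun p : ℝ × ℝ × ℝ => E p.1 p.2.1 :=
      hE.comp (f := fun p : ℝ × ℝ × ℝ => (p.1, p.2.1)) (by fun_prop)
    fun_prop
  · unfold FE'
    have : Continuous fun p : ℝ × ℝ × ℝ => D p.1 p.2.1 :=
      hD.comp (f := fun p : ℝ × ℝ × ℝ => (p.1, p.2.1)) (by fun_prop)
    have h1 : Continuous fun p : ℝ × ℝ × ℝ => deriv vhat p.2.2 • ContinuousLinearMap.snd ℝ ℝ ℝ := by
      fun_prop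
    have h2 : Continuous fun p : ℝ × ℝ × ℝ => -(D p.1 p.2.1) • ContinuousLinearMap.fst ℝ ℝ ℝ := by
      fun_prop
    have h3 := (continuous_const (y := ContinuousLinearMap.inl ℝ ℝ ℝ)).clm_comp h1
    have h4 := (continuous_const (y := ContinuousLinearMap.inr ℝ ℝ ℝ)).clm_comp h2
    refine (h3.add h4).congr fun p => ?_
    ext <;> simp
  · intro t z
    have h1 := (vhat_hasDerivAt z.2).comp_hasFDerivAt z (hasFDerivAt_snd (𝕜 := ℝ) (E := ℝ) (F := ℝ))
    have h2 := ((h.hasD t z.1).neg).comp_hasFDerivAt z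
      (hasFDerivAt_fst (𝕜 := ℝ) (E := ℝ) (F := ℝ))
    exact h1.prodMk h2
  · intro T
    obtain ⟨B, hB, hb⟩ := h.bound T
    exact ⟨1 + B, by linarith, fun t ht z =>
      ⟨FE_norm_le (fun x => (hb t ht x).1) z, FE'_norm_le (fun x => (hb t ht x).2) z⟩⟩

/-- the transported density -/
noncomputable def fE (f₀ : ℝ → ℝ → ℝ) (E : ℝ → ℝ → ℝ) (t x v : ℝ) : ℝ :=
  f₀ (YY (FE E) t (x, v)).1 (YY (FE E) t (x, v)).2

section
variable {f₀ : ℝ → ℝ → ℝ} {E D : ℝ → ℝ → ℝ}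

theorem fE_contDiff (hf : ContDiff ℝ 1 fun p : ℝ × ℝ => f₀ p.1 p.2) (h : GoodE E D) :
    ContDiff ℝ 1 (fun p : ℝ × ℝ × ℝ => fE f₀ E p.1 p.2.1 p.2.2) := by
  obtain ⟨M, -, -, -, h4⟩ := h.field.YY_fderiv
  exact hf.comp h4

theorem fE_zero (h : GoodE E D) (x v : ℝ) : fE f₀ E 0 x v = f₀ x v := by
  obtain ⟨γ, h1, h2⟩ := h.field.exists_sol (t₀ := 0) (N := 1) (by simp) (x, v)
  have := h.field.YY_spec h2 (t := 0) (by simp)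
  rw [h1] at this
  rw [fE, this]

theorem fE_transport (hf : ContDiff ℝ 1 fun p : ℝ × ℝ => f₀ p.1 p.2) (h : GoodE E D) (t x v : ℝ) :
    deriv (fun s => fE f₀ E s x v) t + vhat v * deriv (fun y => fE f₀ E t y v) x
        - E t x * deriv (fun w => fE f₀ E t x w) v = 0 := by
  obtain ⟨M, -, h2, h3, -⟩ := h.field.YY_fderiv
  have hp := (hf.differentiable (by simp) (YY (FE E) t (x, v))).hasFDerivAt
  set p := fderiv ℝ (fun p : ℝ × ℝ => f₀ p.1 p.2) (YY (FE E) t (x, v))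
  have d1 : HasDerivAt (fun s => fE f₀ E s x v) (p (-(M t (x, v) (FE E t (x, v))))) t :=
    HasFDerivAt.comp_hasDerivAt (f := fun s => YY (FE E) s (x, v)) t hp (h3 t (x, v))
  have hx : HasDerivAt (fun y : ℝ => (y, v)) ((1:ℝ), (0:ℝ)) x :=
    (hasDerivAt_id x).prodMk (hasDerivAt_const x v)
  have hv : HasDerivAt (fun w : ℝ => (x, w)) ((0:ℝ), (1:ℝ)) v :=
    (hasDerivAt_const v x).prodMk (hasDerivAt_id v)
  have d2 : HasDerivAt (fun y => fE f₀ E t y v) (p (M t (x, v) (1, 0))) x :=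
    HasFDerivAt.comp_hasDerivAt (f := fun y => YY (FE E) t (y, v)) x hp
      (HasFDerivAt.comp_hasDerivAt (f := fun y : ℝ => (y, v)) x (h2 t (x, v)) hx)
  have d3 : HasDerivAt (fun w => fE f₀ E t x w) (p (M t (x, v) (0, 1))) v :=
    HasFDerivAt.comp_hasDerivAt (f := fun w => YY (FE E) t (x, w)) v hp
      (HasFDerivAt.comp_hasDerivAt (f := fun w : ℝ => (x, w)) v (h2 t (x, v)) hv)
  rw [d1.deriv, d2.deriv, d3.deriv]
  have : FE E t (x, v) = vhat v • ((1:ℝ), (0:ℝ)) - E t x • ((0:ℝ), (1:ℝ)) := by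
    simp [FE]
  rw [this, map_neg, map_sub, map_sub, map_smul, map_smul, map_smul, map_smul]
  simp only [smul_eq_mul]
  ring

theorem fE_abs_le {m : ℝ} (hm : ∀ x v, |f₀ x v| ≤ m) (t x v : ℝ) : |fE f₀ E t x v| ≤ m := hm _ _

theorem real_mvt {k k' : ℝ → ℝ} {C a b : ℝ} (hk : ∀ s ∈ uIcc a b, HasDerivAt k (k' s) s)
    (hC : ∀ s ∈ uIcc a b, |k' s| ≤ C) : |k b - k a| ≤ C * |b - a| := by
  have := Convex.norm_image_sub_le_of_norm_hasDerivWithin_le (f := k) (f' := k') (s := uIcc a b)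
    (C := C) (fun s hs => (hk s hs).hasDerivWithinAt) hC (convex_uIcc _ _) left_mem_uIcc
    right_mem_uIcc
  simpa using this

/-- support bound -/
theorem fE_support (h : GoodE E D) {P B : ℝ} (hP : ∀ x v, P < |x| ∨ P < |v| → f₀ x v = 0) {t : ℝ}
    (hB : ∀ s ∈ uIcc t 0, ∀ x, |E s x| ≤ B) (x v : ℝ)
    (hxv : P + |t| < |x| ∨ P + B * |t| < |v|) : fE f₀ E t x v = 0 := by
  obtain ⟨γ, h1, h2⟩ := h.field.exists_sol (mem_Ioo_abs t) (x, v)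
  have e := h.field.YY_spec h2 (mem_Ioo_abs t)
  rw [h1] at e
  have h0 : (0:ℝ) ∈ Ioo (-(|t| + 1)) (|t| + 1) := by
    constructor <;> linarith [abs_nonneg t]
  have hd : ∀ s ∈ uIcc t 0, HasDerivAt γ (FE E s (γ s)) s := fun s hs =>
    h2 s (uIcc_sub_Ioo (mem_Ioo_abs t) h0 hs)
  rw [fE, e]
  apply hP
  refine hxv.imp (fun hx => ?_) (fun hv => ?_)
  · have := real_mvt (a := t) (b := 0) (C := 1) (k := fun s => (γ s).1)
      (fun s hs => (hasFDerivAt_fst (𝕜 := ℝ) (E := ℝ) (F := ℝ)).comp_hasDerivAt s (hd s hs))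
      (fun s hs => (vhat_abs_lt _).le)
    rw [h1] at this
    simp only [zero_sub, abs_neg, one_mul] at this
    have h5 := abs_sub_abs_le_abs_sub x (γ 0).1
    rw [abs_sub_comm] at h5
    linarith
  · have := real_mvt (a := t) (b := 0) (C := B) (k := fun s => (γ s).2)
      (fun s hs => (hasFDerivAt_snd (𝕜 := ℝ) (E := ℝ) (F := ℝ)).comp_hasDerivAt s (hd s hs))
      (fun s hs => by
        have := hB s hs (γ s).1
        simpa [FE] using this)
    rw [h1] at this
    simp only [zero_sub, abs_neg] at this
    have h5 := abs_sub_abs_le_abs_sub v (γ 0).2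
    rw [abs_sub_comm] at h5
    linarith

theorem fE_dv_le (h : GoodE E D) {L₀ B T : ℝ} (hL0 : 0 ≤ L₀)
    (hL : ∀ a b : ℝ × ℝ, |f₀ a.1 a.2 - f₀ b.1 b.2| ≤ L₀ * ‖a - b‖) (hB0 : 0 ≤ B)
    (hB : ∀ t, |t| ≤ T + 1 → ∀ x, |D t x| ≤ B) {t : ℝ} (ht : |t| ≤ T) (x v : ℝ) :
    |deriv (fun w => fE f₀ E t x w) v| ≤ L₀ * Real.exp ((1 + B) * T) := by
  have := norm_deriv_le_of_lip' (𝕜 := ℝ) (f := fun w => fE f₀ E t x w) (x₀ := v)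
    (C := L₀ * Real.exp ((1 + B) * T)) (by positivity) (Filter.Eventually.of_forall fun w => by
      refine (hL _ _).trans ?_
      have := h.field.YY_lip (K := 1 + B) (by positivity)
        (fun t ht z => FE'_norm_le (hB t ht) z) ht (x, w) (x, v)
      calc _ ≤ L₀ * (‖(x, w) - (x, v)‖ * Real.exp ((1 + B) * T)) := by gcongr
        _ = _ := by
          rw [Prod.mk_sub_mk, sub_self, Prod.norm_def]
          simp only [norm_zero, norm_nonneg, sup_of_le_right]
          ring)
  exact this

/-- chain rule along curves. -/
theorem chain3 {g : ℝ → ℝ → ℝ → ℝ} (hg : ContDiff ℝ 1 (fun p : ℝ × ℝ × ℝ => g p.1 p.2.1 p.2.2))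
    {a b : ℝ → ℝ} {a' b' s : ℝ} (ha : HasDerivAt a a' s) (hb : HasDerivAt b b' s) :
    HasDerivAt (fun s => g s (a s) (b s)) (deriv (fun r => g r (a s) (b s)) s
      + a' * deriv (fun y => g s y (b s)) (a s) + b' * deriv (fun w => g s (a s) w) (b s)) s := by
  have hp := (hg.differentiable (by simp) (s, a s, b s)).hasFDerivAt
  set p := fderiv ℝ (fun p : ℝ × ℝ × ℝ => g p.1 p.2.1 p.2.2) (s, a s, b s)
  have d0 : HasDerivAt (fun s => g s (a s) (b s)) (p (1, a', b')) s :=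
    HasFDerivAt.comp_hasDerivAt (f := fun s => (s, a s, b s)) s hp
      ((hasDerivAt_id s).prodMk (ha.prodMk hb))
  have d1 : HasDerivAt (fun r => g r (a s) (b s)) (p (1, 0, 0)) s :=
    HasFDerivAt.comp_hasDerivAt (f := fun r => (r, a s, b s)) s hp
      ((hasDerivAt_id s).prodMk ((hasDerivAt_const s (a s)).prodMk (hasDerivAt_const s (b s))))
  have d2 : HasDerivAt (fun y => g s y (b s)) (p (0, 1, 0)) (a s) :=
    HasFDerivAt.comp_hasDerivAt (f := fun y => (s, y, b s)) (a s) hp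
      ((hasDerivAt_const _ s).prodMk ((hasDerivAt_id _).prodMk (hasDerivAt_const _ (b s))))
  have d3 : HasDerivAt (fun w => g s (a s) w) (p (0, 0, 1)) (b s) :=
    HasFDerivAt.comp_hasDerivAt (f := fun w => (s, a s, w)) (b s) hp
      ((hasDerivAt_const _ s).prodMk ((hasDerivAt_const _ (a s)).prodMk (hasDerivAt_id _)))
  rw [d1.deriv, d2.deriv, d3.deriv]
  refine d0.congr_deriv ?_
  have : ((1:ℝ), a', b') = (1, 0, 0) + a' • ((0:ℝ), (1:ℝ), (0:ℝ)) + b' • ((0:ℝ), (0:ℝ), (1:ℝ)) := by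
    simp
  rw [this, map_add, map_add, map_smul, map_smul]
  rfl

/-- stability of transport. -/
theorem stability (h : GoodE E D) {E₂ : ℝ → ℝ → ℝ} {g : ℝ → ℝ → ℝ → ℝ}
    (hg : ContDiff ℝ 1 (fun p : ℝ × ℝ × ℝ => g p.1 p.2.1 p.2.2))
    (hg0 : ∀ x v, g 0 x v = f₀ x v) {t G e : ℝ} (ht : 0 ≤ t)
    (hG : ∀ s ∈ Ioo 0 t, ∀ x v, |deriv (fun w => g s x w) v| ≤ G)
    (htr : ∀ s ∈ Ioo 0 t, ∀ x v, deriv (fun r => g r x v) s + vhat v * deriv (fun y => g s y v) x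
        - E₂ s x * deriv (fun w => g s x w) v = 0)
    (he : ∀ s ∈ Ioo 0 t, ∀ x, |E s x - E₂ s x| ≤ e) (x v : ℝ) :
    |fE f₀ E t x v - g t x v| ≤ t * (G * e) := by
  rcases ht.eq_or_lt with rfl | htp
  · rw [fE_zero h, hg0]; simp
  obtain ⟨γ, h1, h2⟩ := h.field.exists_sol (mem_Ioo_abs t) (x, v)
  have e1 := h.field.YY_spec h2 (mem_Ioo_abs t)
  rw [h1] at e1
  have hd : ∀ s ∈ Icc 0 t, HasDerivAt γ (FE E s (γ s)) s := fun s hs =>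
    h2 s ⟨by linarith [hs.1, abs_nonneg t], by linarith [hs.2, le_abs_self t]⟩
  have hk : ∀ s ∈ Icc 0 t, HasDerivAt (fun s => g s (γ s).1 (γ s).2) _ s := fun s hs =>
    chain3 hg (a := fun s => (γ s).1) (b := fun s => (γ s).2)
      ((hasFDerivAt_fst (𝕜 := ℝ) (E := ℝ) (F := ℝ)).comp_hasDerivAt s (hd s hs))
      ((hasFDerivAt_snd (𝕜 := ℝ) (E := ℝ) (F := ℝ)).comp_hasDerivAt s (hd s hs))
  obtain ⟨c, hc, hceq⟩ := exists_hasDerivAt_eq_slope _ _ htp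
    (fun s hs => (hk s hs).continuousAt.continuousWithinAt)
    (fun s hs => hk s (Ioo_subset_Icc_self hs))
  rw [fE, e1, ← hg0]
  rw [h1, sub_zero, eq_div_iff htp.ne'] at hceq
  simp only [FE, ContinuousLinearMap.coe_fst', ContinuousLinearMap.coe_snd'] at hceq
  rw [abs_sub_comm, ← hceq, abs_mul, abs_of_pos htp, mul_comm]
  gcongr
  have h3 := htr c hc (γ c).1 (γ c).2
  have h4 := hG c hc (γ c).1 (γ c).2
  have h5 := he c hc (γ c).1
  have : deriv (fun r => g r (γ c).1 (γ c).2) c + vhat (γ c).2 * deriv (fun y => g c y (γ c).2) (γ c).1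
      + -E c (γ c).1 * deriv (fun w => g c (γ c).1 w) (γ c).2
      = - ((deriv (fun w => g c (γ c).1 w) (γ c).2) * (E c (γ c).1 - E₂ c (γ c).1)) := by linarith
  rw [this, abs_neg, abs_mul]
  have : 0 ≤ G := (abs_nonneg _).trans h4
  gcongr
end

/-- locally uniformly bounded velocity support -/
def VSupp (f : ℝ → ℝ → ℝ → ℝ) : Prop :=
  ∀ T : ℝ, ∃ P : ℝ, ∀ t, |t| ≤ T → ∀ x v, P < |v| → f t x v = 0

/-- velocity moment -/
noncomputable def mom (a : ℝ → ℝ) (f : ℝ → ℝ → ℝ → ℝ) (t x : ℝ) : ℝ := ∫ v, a v * f t x v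

theorem jcur_eq_mom (f : ℝ → ℝ → ℝ → ℝ) : jcur f = mom vhat f := rfl

/-- x derivative of a density -/
noncomputable def dxf (f : ℝ → ℝ → ℝ → ℝ) (t x v : ℝ) : ℝ := deriv (fun y => f t y v) x

section
variable {f : ℝ → ℝ → ℝ → ℝ}

theorem mom_cont {a : ℝ → ℝ} (ha : Continuous a)
    (hf : Continuous (fun p : ℝ × ℝ × ℝ => f p.1 p.2.1 p.2.2)) (hs : VSupp f) :
    Continuous fun p : ℝ × ℝ => mom a f p.1 p.2 := by
  unfold mom
  refine cont_mom (X := ℝ × ℝ) ha (H := fun p v => f p.1 p.2 v) ?_ ?_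
  · exact hf.comp (f := fun p : (ℝ × ℝ) × ℝ => (p.1.1, p.1.2, p.2)) (by fun_prop)
  · rintro ⟨t, x⟩
    obtain ⟨P, hP⟩ := hs (|t| + 1)
    refine ⟨P, ?_⟩
    have : ∀ᶠ p : ℝ × ℝ in nhds (t, x), |p.1| < |t| + 1 := by
      have hc : Continuous fun p : ℝ × ℝ => |p.1| := by fun_prop
      exact hc.continuousAt.eventually (gt_mem_nhds (by simp))
    filter_upwards [this] with p hp v hv
    exact hP p.1 hp.le p.2 v hv

theorem partials_cont (hf : ContDiff ℝ 1 (fun p : ℝ × ℝ × ℝ => f p.1 p.2.1 p.2.2)) :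
    (Continuous fun p : ℝ × ℝ × ℝ => deriv (fun r => f r p.2.1 p.2.2) p.1) ∧
    (Continuous fun p : ℝ × ℝ × ℝ => deriv (fun y => f p.1 y p.2.2) p.2.1) ∧
    (Continuous fun p : ℝ × ℝ × ℝ => deriv (fun w => f p.1 p.2.1 w) p.2.2) ∧
    (∀ t x v, HasDerivAt (fun r => f r x v) (deriv (fun r => f r x v) t) t) ∧
    (∀ t x v, HasDerivAt (fun y => f t y v) (deriv (fun y => f t y v) x) x) ∧
    (∀ t x v, HasDerivAt (fun w => f t x w) (deriv (fun w => f t x w) v) v) := by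
  have hc := hf.continuous_fderiv (by simp)
  have hp := fun q => (hf.differentiable (by simp) q).hasFDerivAt
  set p := fderiv ℝ (fun p : ℝ × ℝ × ℝ => f p.1 p.2.1 p.2.2)
  have d1 : ∀ t x v, HasDerivAt (fun r => f r x v) (p (t, x, v) (1, 0, 0)) t := fun t x v =>
    HasFDerivAt.comp_hasDerivAt (f := fun r => (r, x, v)) t (hp _)
      ((hasDerivAt_id t).prodMk ((hasDerivAt_const t x).prodMk (hasDerivAt_const t v)))
  have d2 : ∀ t x v, HasDerivAt (fun y => f t y v) (p (t, x, v) (0, 1, 0)) x := fun t x v =>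
    HasFDerivAt.comp_hasDerivAt (f := fun y => (t, y, v)) x (hp _)
      ((hasDerivAt_const _ t).prodMk ((hasDerivAt_id _).prodMk (hasDerivAt_const _ v)))
  have d3 : ∀ t x v, HasDerivAt (fun w => f t x w) (p (t, x, v) (0, 0, 1)) v := fun t x v =>
    HasFDerivAt.comp_hasDerivAt (f := fun w => (t, x, w)) v (hp _)
      ((hasDerivAt_const _ t).prodMk ((hasDerivAt_const _ x).prodMk (hasDerivAt_id _)))
  refine ⟨?_, ?_, ?_, fun t x v => ?_, fun t x v => ?_, fun t x v => ?_⟩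
  · refine (hc.clm_apply (continuous_const (y := ((1:ℝ), (0:ℝ), (0:ℝ))))).congr fun q => ?_
    exact (d1 q.1 q.2.1 q.2.2).deriv.symm
  · refine (hc.clm_apply (continuous_const (y := ((0:ℝ), (1:ℝ), (0:ℝ))))).congr fun q => ?_
    exact (d2 q.1 q.2.1 q.2.2).deriv.symm
  · refine (hc.clm_apply (continuous_const (y := ((0:ℝ), (0:ℝ), (1:ℝ))))).congr fun q => ?_
    exact (d3 q.1 q.2.1 q.2.2).deriv.symm
  · exact (d1 t x v).differentiableAt.hasDerivAt
  · exact (d2 t x v).differentiableAt.hasDerivAt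
  · exact (d3 t x v).differentiableAt.hasDerivAt

theorem dxf_vsupp (hs : VSupp f) : VSupp (dxf f) := by
  intro T
  obtain ⟨P, hP⟩ := hs T
  refine ⟨P, fun t ht x v hv => ?_⟩
  unfold dxf
  rw [show (fun y => f t y v) = fun _ => 0 from funext fun y => hP t ht y v hv, deriv_const]

theorem mom_hasDerivAt_x {a : ℝ → ℝ} (ha : Continuous a)
    (hf : ContDiff ℝ 1 (fun p : ℝ × ℝ × ℝ => f p.1 p.2.1 p.2.2)) (hs : VSupp f) (t x : ℝ) :
    HasDerivAt (fun x => mom a f t x) (mom a (dxf f) t x) x := by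
  obtain ⟨-, c2, -, -, d2, -⟩ := partials_cont hf
  obtain ⟨P, hP⟩ := hs |t|
  refine hasDerivAt_mom ha (H := fun x v => f t x v) (H' := fun x v => dxf f t x v) ?_ ?_
    (fun s v => d2 t s v) x ⟨P, Filter.Eventually.of_forall fun s v hv => hP t le_rfl s v hv⟩
  · exact hf.continuous.comp (f := fun p : ℝ × ℝ => (t, p.1, p.2)) (by fun_prop)
  · exact c2.comp (f := fun p : ℝ × ℝ => (t, p.1, p.2)) (by fun_prop)

theorem integrable_of_vs {h : ℝ → ℝ} (hc : Continuous h) {P : ℝ} (hz : ∀ v, P < |v| → h v = 0) :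
    Integrable h := by
  apply hc.integrable_of_hasCompactSupport
  apply HasCompactSupport.intro (isCompact_Icc (a := -P) (b := P))
  intro v hv
  apply hz
  by_contra hc
  exact hv (abs_le.1 (not_lt.1 hc))

/-- right-hand side of the light-cone formula -/
noncomputable def RR (σ : ℝ) (E : ℝ → ℝ → ℝ) (f : ℝ → ℝ → ℝ → ℝ) (t x : ℝ) : ℝ :=
  mom (asig σ) f 0 (x + σ * t) - mom (asig σ) f t x
    - II σ (fun s y => E s y * mom (deriv (asig σ)) f s y) t x

theorem II_jx {σ : ℝ} (hσ : |σ| = 1) {E : ℝ → ℝ → ℝ} (hE : Continuous fun p : ℝ × ℝ => E p.1 p.2)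
    (hf : ContDiff ℝ 1 (fun p : ℝ × ℝ × ℝ => f p.1 p.2.1 p.2.2)) (hs : VSupp f)
    (htr : ∀ s x v, deriv (fun r => f r x v) s + vhat v * deriv (fun y => f s y v) x
        - E s x * deriv (fun w => f s x w) v = 0) (t x : ℝ) :
    II σ (mom vhat (dxf f)) t x = RR σ E f t x := by
  obtain ⟨c1, c2, c3, d1, d2, d3⟩ := partials_cont hf
  have hvc := vhat_contDiff.continuous
  have hac := (asig_contDiff hσ).continuous
  have hac' := (asig_contDiff hσ).continuous_deriv (by simp)
  have hn := mom_cont hac' hf.continuous hs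
  have hj := mom_cont (f := dxf f) hvc c2 (dxf_vsupp hs)
  have key : ∀ s, HasDerivAt (fun s => mom (asig σ) f s (x + σ * (t - s)))
      (-(mom vhat (dxf f) s (x + σ * (t - s)))
        - E s (x + σ * (t - s)) * mom (deriv (asig σ)) f s (x + σ * (t - s))) s := by
    intro s
    obtain ⟨P, hP⟩ := hs (|s| + 1)
    have hy : ∀ s, HasDerivAt (fun s => x + σ * (t - s)) (-σ) s := by
      intro s
      simpa using (((hasDerivAt_id s).const_sub t).const_mul σ).const_add x
    have hlen : ∀ᶠ r in nhds s, |r| < |s| + 1 :=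
      continuous_abs.continuousAt.eventually (gt_mem_nhds (by simp))
    have h1 := hasDerivAt_mom hac (H := fun s v => f s (x + σ * (t - s)) v)
      (H' := fun s v => deriv (fun r => f r (x + σ * (t - s)) v) s
        + (-σ) * deriv (fun y => f s y v) (x + σ * (t - s)) + 0 * deriv (fun w => f s (x + σ * (t - s)) w) v)
      (hf.continuous.comp (f := fun p : ℝ × ℝ => (p.1, x + σ * (t - p.1), p.2)) (by fun_prop))
      (by
        have i1 := c1.comp (f := fun p : ℝ × ℝ => (p.1, x + σ * (t - p.1), p.2)) (by fun_prop)
        have i2 := c2.comp (f := fun p : ℝ × ℝ => (p.1, x + σ * (t - p.1), p.2)) (by fun_prop)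
        have i3 := c3.comp (f := fun p : ℝ × ℝ => (p.1, x + σ * (t - p.1), p.2)) (by fun_prop)
        exact (i1.add (i2.const_mul _)).add (i3.const_mul _))
      (fun s v => chain3 hf (hy s) (hasDerivAt_const s v)) s
      ⟨P, by filter_upwards [hlen] with r hr v hv using hP r hr.le _ v hv⟩
    refine h1.congr_deriv ?_
    set y := x + σ * (t - s)
    have hPs : ∀ x v, P < |v| → f s x v = 0 := fun x v hv => hP s (by linarith) x v hv
    have hI1 : Integrable fun v => vhat v * dxf f s y v := by
      refine integrable_of_vs (P := P) (hvc.mul ?_) fun v hv => ?_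
      · exact c2.comp (f := fun v : ℝ => (s, y, v)) (by fun_prop)
      · unfold dxf
        rw [show (fun y => f s y v) = fun _ => 0 from funext fun y => hPs y v hv, deriv_const,
          mul_zero]
    have c3' : Continuous fun v => deriv (fun w => f s y w) v :=
      c3.comp (f := fun v : ℝ => (s, y, v)) (by fun_prop)
    have hI2 : Integrable fun v => asig σ v * deriv (fun w => f s y w) v := by
      refine integrable_of_vs (P := P) (hac.mul c3') fun v hv => ?_
      have : deriv (fun w => f s y w) v = 0 := by
        have hev : (fun w => f s y w) =ᶠ[nhds v] fun _ => 0 := by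
          have : ∀ᶠ w in nhds v, P < |w| :=
            (continuous_abs.tendsto v).eventually (lt_mem_nhds hv)
          filter_upwards [this] with w hw using hPs y w hw
        rw [hev.deriv_eq, deriv_const]
      rw [this, mul_zero]
    have hbp := mom_by_parts (fun v => ((asig_contDiff hσ).differentiable (by simp) v).hasDerivAt)
      hac' (fun v => d3 s y v) c3' (P := P) (hPs y)
    have : (fun v => asig σ v * (deriv (fun r => f r y v) s
        + (-σ) * deriv (fun y => f s y v) y + 0 * deriv (fun w => f s y w) v)) =
        fun v => -(vhat v * dxf f s y v) + E s y * (asig σ v * deriv (fun w => f s y w) v) := by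
      funext v
      have h3 := htr s y v
      have h4 : asig σ v * (vhat v + σ) = vhat v := by
        unfold asig
        exact div_mul_cancel₀ _ (vhat_add_ne hσ v)
      have h5 : deriv (fun r => f r y v) s + (-σ) * deriv (fun y => f s y v) y
          + 0 * deriv (fun w => f s y w) v
          = -(vhat v + σ) * dxf f s y v + E s y * deriv (fun w => f s y w) v := by
        unfold dxf; linarith
      rw [h5]
      linear_combination (-dxf f s y v) * h4
    have hI1' : Integrable fun v => -(vhat v * dxf f s y v) := hI1.neg
    have hI2' : Integrable fun v => E s y * (asig σ v * deriv (fun w => f s y w) v) :=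
      hI2.const_mul _
    rw [this, integral_add hI1' hI2', MeasureTheory.integral_neg, MeasureTheory.integral_const_mul, hbp]
    unfold mom
    ring
  have hjr : Continuous fun s => mom vhat (dxf f) s (x + σ * (t - s)) :=
    hj.comp (f := fun s : ℝ => (s, x + σ * (t - s))) (by fun_prop)
  have hEr : Continuous fun s => E s (x + σ * (t - s)) * mom (deriv (asig σ)) f s (x + σ * (t - s)) :=
    (hE.mul hn).comp (f := fun s : ℝ => (s, x + σ * (t - s))) (by fun_prop)
  have hftc := integral_eq_sub_of_hasDerivAt (a := 0) (b := t) (fun s _ => key s)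
    ((hjr.neg.sub hEr).intervalIntegrable _ _)
  have hjn : Continuous fun s => -(mom vhat (dxf f) s (x + σ * (t - s))) := hjr.neg
  rw [intervalIntegral.integral_sub (hjn.intervalIntegrable _ _) (hEr.intervalIntegrable _ _),
    intervalIntegral.integral_neg] at hftc
  unfold RR
  simp only [II] at *
  simp only [sub_self, mul_zero, add_zero, sub_zero] at hftc
  linarith

theorem II_diff (σ : ℝ) {G₁ G₂ : ℝ → ℝ → ℝ} {t : ℝ} (ht : 0 ≤ t) (x : ℝ)
    (h1 : Continuous fun p : ℝ × ℝ => G₁ p.1 p.2) (h2 : Continuous fun p : ℝ × ℝ => G₂ p.1 p.2)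
    {d : ℝ → ℝ} (hd : Continuous d)
    (hb : ∀ s ∈ Icc 0 t, ∀ y, |G₁ s y - G₂ s y| ≤ d s) :
    |II σ G₁ t x - II σ G₂ t x| ≤ ∫ s in (0:ℝ)..t, d s := by
  unfold II
  have i1 : Continuous fun s => G₁ s (x + σ * (t - s)) :=
    h1.comp (f := fun s : ℝ => (s, x + σ * (t - s))) (by fun_prop)
  have i2 : Continuous fun s => G₂ s (x + σ * (t - s)) :=
    h2.comp (f := fun s : ℝ => (s, x + σ * (t - s))) (by fun_prop)
  rw [← intervalIntegral.integral_sub (i1.intervalIntegrable _ _) (i2.intervalIntegrable _ _)]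
  refine intervalIntegral.norm_integral_le_of_norm_le (E := ℝ) ht ?_ (hd.intervalIntegrable _ _)
  exact Filter.Eventually.of_forall fun s hs => hb s (Ioc_subset_Icc_self hs) _

theorem mom_diff {a : ℝ → ℝ} (ha : Continuous a) {f g : ℝ → ℝ → ℝ → ℝ} {t P C d : ℝ}
    (hf : Continuous (fun p : ℝ × ℝ × ℝ => f p.1 p.2.1 p.2.2))
    (hg : Continuous (fun p : ℝ × ℝ × ℝ => g p.1 p.2.1 p.2.2))
    (hP : 0 ≤ P) (hC : 0 ≤ C) (hfP : ∀ x v, P < |v| → f t x v = 0)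
    (hgP : ∀ x v, P < |v| → g t x v = 0)
    (haC : ∀ v, |v| ≤ P → |a v| ≤ C) (hd : ∀ x v, |f t x v - g t x v| ≤ d) (x : ℝ) :
    |mom a f t x - mom a g t x| ≤ 2 * P * (C * d) := by
  unfold mom
  have c1 : Continuous fun v => f t x v := hf.comp (f := fun v : ℝ => (t, x, v)) (by fun_prop)
  have c2 : Continuous fun v => g t x v := hg.comp (f := fun v : ℝ => (t, x, v)) (by fun_prop)
  have i1 : Integrable fun v => a v * f t x v :=
    integrable_of_vs (P := P) (ha.mul c1) fun v hv => by rw [hfP x v hv, mul_zero]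
  have i2 : Integrable fun v => a v * g t x v :=
    integrable_of_vs (P := P) (ha.mul c2) fun v hv => by rw [hgP x v hv, mul_zero]
  rw [← integral_sub i1 i2]
  simp only [← mul_sub]
  exact mom_bound (h := fun v => f t x v - g t x v) hP hC haC (hd x)
    (fun v hv => by rw [hfP x v hv, hgP x v hv, sub_zero])

/-- stability of the light-cone expression -/
theorem RR_diff {σ : ℝ} (hσ : |σ| = 1) {E₁ E₂ : ℝ → ℝ → ℝ} {f g : ℝ → ℝ → ℝ → ℝ}
    (hE₁ : Continuous fun p : ℝ × ℝ => E₁ p.1 p.2) (hE₂ : Continuous fun p : ℝ × ℝ => E₂ p.1 p.2)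
    (hf : Continuous (fun p : ℝ × ℝ × ℝ => f p.1 p.2.1 p.2.2))
    (hg : Continuous (fun p : ℝ × ℝ × ℝ => g p.1 p.2.1 p.2.2)) (hfs : VSupp f) (hgs : VSupp g)
    {T P C d e B m t : ℝ} (hP : 0 ≤ P) (hC : 0 ≤ C) (hB : 0 ≤ B) (he : 0 ≤ e)
    (ht : t ∈ Icc 0 T)
    (hfP : ∀ t ∈ Icc 0 T, ∀ x v, P < |v| → f t x v = 0)
    (hgP : ∀ t ∈ Icc 0 T, ∀ x v, P < |v| → g t x v = 0)
    (haC : ∀ v, |v| ≤ P → |asig σ v| ≤ C) (haC' : ∀ v, |v| ≤ P → |deriv (asig σ) v| ≤ C)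
    (hd : ∀ t ∈ Icc 0 T, ∀ x v, |f t x v - g t x v| ≤ d)
    (hed : ∀ t ∈ Icc 0 T, ∀ x, |E₁ t x - E₂ t x| ≤ e)
    (hEB : ∀ t ∈ Icc 0 T, ∀ x, |E₁ t x| ≤ B)
    (hgm : ∀ t ∈ Icc 0 T, ∀ x v, |g t x v| ≤ m) (x : ℝ) :
    |RR σ E₁ f t x - RR σ E₂ g t x| ≤
      2 * (2 * P * (C * d)) + T * (B * (2 * P * (C * d)) + e * (2 * P * (C * m))) := by
  have hac := (asig_contDiff hσ).continuous
  have hac' := (asig_contDiff hσ).continuous_deriv (by simp)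
  have hT : 0 ≤ T := ht.1.trans ht.2
  have m1 := mom_diff hac hf hg hP hC (hfP 0 ⟨le_rfl, hT⟩) (hgP 0 ⟨le_rfl, hT⟩) haC
    (hd 0 ⟨le_rfl, hT⟩) (x + σ * t)
  have m2 := mom_diff hac hf hg hP hC (hfP t ht) (hgP t ht) haC (hd t ht) x
  have m0 : 0 ≤ m := (abs_nonneg _).trans (hgm t ht 0 0)
  have d0 : 0 ≤ d := (abs_nonneg _).trans (hd t ht 0 0)
  have m3 := II_diff σ (G₁ := fun s y => E₁ s y * mom (deriv (asig σ)) f s y)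
    (G₂ := fun s y => E₂ s y * mom (deriv (asig σ)) g s y) ht.1 x
    (hE₁.mul (mom_cont hac' hf hfs)) (hE₂.mul (mom_cont hac' hg hgs))
    (d := fun _ => B * (2 * P * (C * d)) + e * (2 * P * (C * m))) continuous_const
    (fun s hs y => by
      have hs' : s ∈ Icc 0 T := ⟨hs.1, hs.2.trans ht.2⟩
      have k1 := mom_diff hac' hf hg hP hC (hfP s hs') (hgP s hs') haC' (hd s hs') y
      have k2 : |mom (deriv (asig σ)) g s y| ≤ 2 * P * (C * m) :=
        mom_bound (h := fun v => g s y v) hP hC haC' (hgm s hs' y) (hgP s hs' y)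
      have : E₁ s y * mom (deriv (asig σ)) f s y - E₂ s y * mom (deriv (asig σ)) g s y =
        E₁ s y * (mom (deriv (asig σ)) f s y - mom (deriv (asig σ)) g s y) +
        (E₁ s y - E₂ s y) * mom (deriv (asig σ)) g s y := by ring
      rw [this]
      refine (abs_add_le _ _).trans ?_
      rw [abs_mul, abs_mul]
      have := hEB s hs' y
      have := hed s hs' y
      gcongr)
  rw [intervalIntegral.integral_const, sub_zero, smul_eq_mul] at m3
  have m4 : t * (B * (2 * P * (C * d)) + e * (2 * P * (C * m))) ≤
      T * (B * (2 * P * (C * d)) + e * (2 * P * (C * m))) := by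
    have := ht.2
    gcongr
  unfold RR
  rw [abs_le] at *
  constructor <;> linarith [m1.1, m1.2, m2.1, m2.2, m3.1, m3.2]
end

/-- the quantitative data -/
structure TData (f₀ : ℝ → ℝ → ℝ) (A₀ A₁ : ℝ → ℝ) (K : ℝ) : Prop where
  hf : ContDiff ℝ 1 (fun p : ℝ × ℝ => f₀ p.1 p.2)
  hA₀ : ContDiff ℝ 2 A₀
  hA₁ : ContDiff ℝ 1 A₁
  K0 : 0 ≤ K
  supp : ∀ x v, K < |x| ∨ K < |v| → f₀ x v = 0
  fb : ∀ x v, |f₀ x v| ≤ K / 2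
  lip : ∀ a b : ℝ × ℝ, |f₀ a.1 a.2 - f₀ b.1 b.2| ≤ K * ‖a - b‖
  a0 : ∀ x, |deriv A₀ x| ≤ K / 2
  a1 : ∀ x, |A₁ x| ≤ K / 2
  a2 : ∀ x, |deriv (deriv A₀) x| ≤ K / 2
  a3 : ∀ x, |deriv A₁ x| ≤ K / 2

/-- a priori bound of the field -/
noncomputable def bet (K s : ℝ) : ℝ := K * Real.exp (K * s + K * s ^ 2)

theorem bet_nonneg {K : ℝ} (hK : 0 ≤ K) (s : ℝ) : 0 ≤ bet K s := by unfold bet; positivity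

theorem bet_mono {K : ℝ} (hK : 0 ≤ K) {s t : ℝ} (hs : 0 ≤ s) (hst : s ≤ t) :
    bet K s ≤ bet K t := by
  unfold bet
  gcongr

theorem bet_hasDerivAt (K s : ℝ) : HasDerivAt (bet K) (bet K s * (K + 2 * K * s)) s := by
  unfold bet
  have h : HasDerivAt (fun s : ℝ => K * s + K * s ^ 2) (K * 1 + K * (2 * s)) s := by
    have := ((hasDerivAt_id s).const_mul K).add (((hasDerivAt_id s).pow 2).const_mul K)
    refine this.congr_deriv ?_
    simp
  refine (h.exp.const_mul K).congr_deriv ?_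
  ring

theorem bet_cont (K : ℝ) : Continuous (bet K) := by unfold bet; fun_prop

theorem bet_int {K : ℝ} (hK : 0 ≤ K) {t : ℝ} (ht : 0 ≤ t) :
    K + ∫ s in (0:ℝ)..t, 2 * (K + bet K s * s) * (1 * (K / 2)) ≤ bet K t := by
  have hb := bet_cont K
  have h1 := integral_eq_sub_of_hasDerivAt (a := 0) (b := t) (fun s _ => bet_hasDerivAt K s)
    (Continuous.intervalIntegrable (by fun_prop) _ _)
  have h2 : ∫ s in (0:ℝ)..t, 2 * (K + bet K s * s) * (1 * (K / 2)) ≤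
      ∫ s in (0:ℝ)..t, bet K s * (K + 2 * K * s) := by
    apply intervalIntegral.integral_mono_on ht
      (Continuous.intervalIntegrable (by fun_prop) _ _)
      (Continuous.intervalIntegrable (by fun_prop) _ _)
    intro s hs
    have h3 := bet_nonneg hK s
    have h4 : K ≤ bet K s := by
      have := bet_mono hK le_rfl hs.1
      simpa [bet] using this
    have h5 : K * K ≤ bet K s * K := by gcongr
    have h6 : 0 ≤ bet K s * K * s := mul_nonneg (mul_nonneg h3 hK) hs.1
    nlinarith
  have h0 : bet K 0 = K := by simp [bet]
  linarith

/-- velocity radius -/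
noncomputable def PP (K T : ℝ) : ℝ := K + bet K T * T

theorem PP_nonneg {K T : ℝ} (hK : 0 ≤ K) (hT : 0 ≤ T) : 0 ≤ PP K T := by
  have := bet_nonneg hK T
  unfold PP; positivity

/-- admissible fields -/
structure Adm (K : ℝ) (E D : ℝ → ℝ → ℝ) : Prop where
  good : GoodE E D
  bd : ∀ t x, |E t x| ≤ bet K |t|

/-- next field -/
noncomputable def SE (A₀ A₁ : ℝ → ℝ) (f : ℝ → ℝ → ℝ → ℝ) (t x : ℝ) : ℝ :=
  EE A₀ A₁ (jcur f) (max t 0) x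

/-- derivative of next field -/
noncomputable def SD (A₀ A₁ : ℝ → ℝ) (f : ℝ → ℝ → ℝ → ℝ) (t x : ℝ) : ℝ :=
  EE (deriv A₀) (deriv A₁) (mom vhat (dxf f)) (max t 0) x

theorem EE_bound {A₀ A₁ : ℝ → ℝ} {K b : ℝ} (h0 : ∀ x, |deriv A₀ x| ≤ K / 2) (h1 : ∀ x, |A₁ x| ≤ K / 2)
    {j : ℝ → ℝ → ℝ} {t x : ℝ} (hp : |II 1 j t x| ≤ b) (hm : |II (-1) j t x| ≤ b) :
    |EE A₀ A₁ j t x| ≤ K + b := by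
  unfold EE
  have a := abs_le.1 (h0 (x + t))
  have a' := abs_le.1 (h0 (x - t))
  have c := abs_le.1 (h1 (x + t))
  have c' := abs_le.1 (h1 (x - t))
  rw [abs_le] at *
  constructor <;> linarith [a.1, a.2, a'.1, a'.2, c.1, c.2, c'.1, c'.2]

theorem EE_diff_of {A₀ A₁ : ℝ → ℝ} {b : ℝ}
    {j k : ℝ → ℝ → ℝ} {t x : ℝ} (hp : |II 1 j t x - II 1 k t x| ≤ b)
    (hm : |II (-1) j t x - II (-1) k t x| ≤ b) :
    |EE A₀ A₁ j t x - EE A₀ A₁ k t x| ≤ b := by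
  unfold EE
  rw [abs_le] at *
  constructor <;> linarith [hp.1, hp.2, hm.1, hm.2]

theorem max_abs_le {t T : ℝ} (h : |t| ≤ T) : max t 0 ∈ Icc 0 T := by
  have h1 := abs_nonneg t
  have h2 := le_abs_self t
  exact ⟨le_max_right _ _, max_le (by linarith) (by linarith)⟩

theorem max_le_abs (t : ℝ) : max t 0 ≤ |t| := max_le (le_abs_self t) (abs_nonneg t)

section
variable {f₀ : ℝ → ℝ → ℝ} {A₀ A₁ : ℝ → ℝ} {K : ℝ} {E D : ℝ → ℝ → ℝ}

theorem adm_supp (d : TData f₀ A₀ A₁ K) (h : Adm K E D) {t T : ℝ} (ht : |t| ≤ T) (x v : ℝ)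
    (hxv : K + T < |x| ∨ PP K T < |v|) : fE f₀ E t x v = 0 := by
  have hT : 0 ≤ T := (abs_nonneg t).trans ht
  refine fE_support h.good d.supp (B := bet K T) (fun s hs x => (h.bd s x).trans ?_) x v ?_
  · refine bet_mono d.K0 (abs_nonneg _) (le_trans ?_ ht)
    have := abs_sub_right_of_mem_uIcc hs
    simpa using this
  · refine hxv.imp (fun h => by linarith) fun hh => ?_
    have := mul_le_mul_of_nonneg_left ht (bet_nonneg d.K0 T)
    unfold PP at hh
    linarith

theorem adm_vsupp (d : TData f₀ A₀ A₁ K) (h : Adm K E D) : VSupp (fE f₀ E) := fun T =>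
  ⟨PP K T, fun _ ht x v hv => adm_supp d h ht x v (Or.inr hv)⟩

theorem adm_j (d : TData f₀ A₀ A₁ K) (h : Adm K E D) :
    (Continuous fun p : ℝ × ℝ => mom vhat (fE f₀ E) p.1 p.2) ∧
    (Continuous fun p : ℝ × ℝ => mom vhat (dxf (fE f₀ E)) p.1 p.2) ∧
    (∀ t x, HasDerivAt (fun x => mom vhat (fE f₀ E) t x) (mom vhat (dxf (fE f₀ E)) t x) x) := by
  have hf := fE_contDiff d.hf h.good
  have hs := adm_vsupp d h
  have hv := vhat_contDiff.continuous
  exact ⟨mom_cont hv hf.continuous hs, mom_cont hv (partials_cont hf).2.1 (dxf_vsupp hs),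
    mom_hasDerivAt_x hv hf hs⟩

theorem SE_bound (d : TData f₀ A₀ A₁ K) (h : Adm K E D) (t x : ℝ) :
    |SE A₀ A₁ (fE f₀ E) t x| ≤ bet K |t| := by
  have ht : 0 ≤ max t 0 := le_max_right _ _
  refine le_trans ?_ (bet_mono d.K0 ht (max_le_abs t))
  refine le_trans ?_ (bet_int d.K0 ht)
  have hj := (adm_j d h).1
  have hb := bet_cont K
  have key : ∀ σ : ℝ, |II σ (jcur (fE f₀ E)) (max t 0) x| ≤
      ∫ s in (0:ℝ)..(max t 0), 2 * (K + bet K s * s) * (1 * (K / 2)) := by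
    intro σ
    have := II_diff σ (G₁ := jcur (fE f₀ E)) (G₂ := fun _ _ => 0) ht x hj continuous_const
      (d := fun s => 2 * (K + bet K s * s) * (1 * (K / 2))) (by fun_prop) (fun s hs y => by
        rw [sub_zero]
        exact mom_bound (h := fun v => fE f₀ E s y v) (PP_nonneg d.K0 hs.1) zero_le_one
          (fun v _ => (vhat_abs_lt v).le) (fE_abs_le d.fb s y)
          (fun v hv => adm_supp d h (T := s) (abs_of_nonneg hs.1).le y v (Or.inr hv)))
    simpa [II] using this
  exact EE_bound d.a0 d.a1 (key 1) (key (-1))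

theorem asig_bd {σ : ℝ} (hσ : |σ| = 1) (P : ℝ) : ∃ C, 0 ≤ C ∧ (∀ v, |v| ≤ P → |asig σ v| ≤ C) ∧
    (∀ v, |v| ≤ P → |deriv (asig σ) v| ≤ C) := by
  have hac := (asig_contDiff hσ).continuous
  have hac' := (asig_contDiff hσ).continuous_deriv (by simp)
  obtain ⟨C, hC⟩ := (isCompact_Icc (a := -P) (b := P)).exists_bound_of_continuousOn hac.continuousOn
  obtain ⟨C', hC'⟩ := (isCompact_Icc (a := -P) (b := P)).exists_bound_of_continuousOn hac'.continuousOn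
  refine ⟨max 0 (max C C'), le_max_left _ _, fun v hv => ?_, fun v hv => ?_⟩
  · exact (hC v (abs_le.1 hv)).trans ((le_max_left _ _).trans (le_max_right _ _))
  · exact (hC' v (abs_le.1 hv)).trans ((le_max_right _ _).trans (le_max_right _ _))

theorem abs_one_neg : |(-1:ℝ)| = 1 := by simp

/-- constant for the light-cone estimates on `[0,T]` -/
theorem asig_bd2 (P : ℝ) : ∃ C, 0 ≤ C ∧ ∀ σ : ℝ, σ = 1 ∨ σ = -1 →
    |σ| = 1 ∧ (∀ v, |v| ≤ P → |asig σ v| ≤ C) ∧ (∀ v, |v| ≤ P → |deriv (asig σ) v| ≤ C) := by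
  obtain ⟨C, h0, h1, h2⟩ := asig_bd (σ := 1) abs_one P
  obtain ⟨C', h0', h1', h2'⟩ := asig_bd (σ := -1) abs_one_neg P
  refine ⟨max C C', le_max_of_le_left h0, ?_⟩
  rintro σ (rfl | rfl)
  · exact ⟨abs_one, fun v hv => (h1 v hv).trans (le_max_left _ _),
      fun v hv => (h2 v hv).trans (le_max_left _ _)⟩
  · exact ⟨abs_one_neg, fun v hv => (h1' v hv).trans (le_max_right _ _),
      fun v hv => (h2' v hv).trans (le_max_right _ _)⟩

/-- SD difference -/
theorem SD_diff (d : TData f₀ A₀ A₁ K) {T : ℝ} (hT : 0 ≤ T) : ∃ N, 0 ≤ N ∧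
    ∀ E D E₂ D₂, Adm K E D → Adm K E₂ D₂ → ∀ dd e : ℝ, 0 ≤ e →
    (∀ t ∈ Icc 0 T, ∀ x v, |fE f₀ E t x v - fE f₀ E₂ t x v| ≤ dd) →
    (∀ t ∈ Icc 0 T, ∀ x, |E t x - E₂ t x| ≤ e) → ∀ t, |t| ≤ T → ∀ x,
    |SD A₀ A₁ (fE f₀ E) t x - SD A₀ A₁ (fE f₀ E₂) t x| ≤ N * (dd + e) := by
  have hP := PP_nonneg d.K0 hT
  obtain ⟨C, hC, hCs⟩ := asig_bd2 (PP K T)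
  have hb := bet_nonneg d.K0 T
  have hK := d.K0
  refine ⟨4 * PP K T * C + T * bet K T * (2 * PP K T * C) + T * (2 * PP K T * (C * (K / 2))),
    by positivity, ?_⟩
  intro E D E₂ D₂ h h₂ dd e he hd hed t ht x
  have ht' := max_abs_le ht
  have hdd : 0 ≤ dd := (abs_nonneg _).trans (hd _ ht' 0 0)
  have key : ∀ σ : ℝ, σ = 1 ∨ σ = -1 →
      |II σ (mom vhat (dxf (fE f₀ E))) (max t 0) x - II σ (mom vhat (dxf (fE f₀ E₂))) (max t 0) x|
      ≤ 2 * (2 * PP K T * (C * dd)) + T * (bet K T * (2 * PP K T * (C * dd))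
        + e * (2 * PP K T * (C * (K / 2)))) := by
    intro σ hσ
    obtain ⟨hσ, hc1, hc2⟩ := hCs σ hσ
    rw [II_jx hσ h.good.cont (fE_contDiff d.hf h.good) (adm_vsupp d h) (fE_transport d.hf h.good),
      II_jx hσ h₂.good.cont (fE_contDiff d.hf h₂.good) (adm_vsupp d h₂)
        (fE_transport d.hf h₂.good)]
    exact RR_diff hσ h.good.cont h₂.good.cont (fE_contDiff d.hf h.good).continuous
      (fE_contDiff d.hf h₂.good).continuous (adm_vsupp d h) (adm_vsupp d h₂) hP hC hb he ht'
      (fun s hs x v hv => adm_supp d h (T := T) (by rw [abs_of_nonneg hs.1]; exact hs.2) x v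
        (Or.inr hv))
      (fun s hs x v hv => adm_supp d h₂ (T := T) (by rw [abs_of_nonneg hs.1]; exact hs.2) x v
        (Or.inr hv)) hc1 hc2 hd hed
      (fun s hs x => (h.bd s x).trans (bet_mono d.K0 (abs_nonneg _)
        (by rw [abs_of_nonneg hs.1]; exact hs.2)))
      (fun s hs x v => fE_abs_le d.fb s x v) x
  refine (EE_diff_of (key 1 (Or.inl rfl)) (key (-1) (Or.inr rfl))).trans ?_
  have e1 : 0 ≤ (4 * PP K T * C + T * bet K T * (2 * PP K T * C)) * e := by positivity
  have e2 : 0 ≤ T * (2 * PP K T * (C * (K / 2))) * dd := by positivity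
  linarith

/-- the zero field is admissible -/
theorem adm_zero (hK : 0 ≤ K) : Adm K (fun _ _ => 0) (fun _ _ => 0) :=
  ⟨⟨continuous_const, continuous_const, fun _ x => hasDerivAt_const x 0,
    fun _ => ⟨0, le_rfl, fun _ _ _ => by simp⟩⟩, fun t _ => by simpa using bet_nonneg hK |t|⟩

theorem SD_bound (d : TData f₀ A₀ A₁ K) {T : ℝ} (hT : 0 ≤ T) : ∃ N, 0 ≤ N ∧
    ∀ E D, Adm K E D → ∀ t, |t| ≤ T → ∀ x, |SD A₀ A₁ (fE f₀ E) t x| ≤ N := by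
  have hP := PP_nonneg d.K0 hT
  obtain ⟨C, hC, hCs⟩ := asig_bd2 (PP K T)
  have hb := bet_nonneg d.K0 T
  have hK := d.K0
  refine ⟨K + (2 * (2 * PP K T * (C * (K / 2))) + T * (bet K T * (2 * PP K T * (C * (K / 2)))
        + bet K T * (2 * PP K T * (C * (K / 2))))),
    by positivity, ?_⟩
  intro E D h t ht x
  have ht' := max_abs_le ht
  have hEb : ∀ s ∈ Icc 0 T, ∀ x, |E s x| ≤ bet K T := fun s hs x =>
    (h.bd s x).trans (bet_mono d.K0 (abs_nonneg _) (by rw [abs_of_nonneg hs.1]; exact hs.2))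
  have key : ∀ σ : ℝ, σ = 1 ∨ σ = -1 →
      |II σ (mom vhat (dxf (fE f₀ E))) (max t 0) x|
      ≤ 2 * (2 * PP K T * (C * (K / 2))) + T * (bet K T * (2 * PP K T * (C * (K / 2)))
        + bet K T * (2 * PP K T * (C * (K / 2)))) := by
    intro σ hσ
    obtain ⟨hσ, hc1, hc2⟩ := hCs σ hσ
    rw [II_jx hσ h.good.cont (fE_contDiff d.hf h.good) (adm_vsupp d h) (fE_transport d.hf h.good)]
    have := RR_diff (E₂ := fun _ _ => 0) (g := fun _ _ _ => 0) (m := K / 2)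
      hσ h.good.cont continuous_const (fE_contDiff d.hf h.good).continuous
      continuous_const (adm_vsupp d h) (fun _ => ⟨0, fun _ _ _ _ _ => rfl⟩) hP hC hb hb ht'
      (fun s hs x v hv => adm_supp d h (T := T) (by rw [abs_of_nonneg hs.1]; exact hs.2) x v
        (Or.inr hv))
      (fun s hs x v hv => rfl) hc1 hc2
      (d := K / 2) (fun s hs x v => by rw [sub_zero]; exact fE_abs_le d.fb s x v)
      (e := bet K T) (fun s hs x => by rw [sub_zero]; exact hEb s hs x) hEb
      (fun s hs x v => by rw [abs_zero]; positivity) x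
    have hz : RR σ (fun _ _ => 0) (fun _ _ _ => 0) (max t 0) x = 0 := by
      simp [RR, mom, II]
    rwa [hz, sub_zero] at this
  exact EE_bound d.a2 d.a3 (key 1 (Or.inl rfl)) (key (-1) (Or.inr rfl))

theorem adm_step (d : TData f₀ A₀ A₁ K) (h : Adm K E D) :
    Adm K (SE A₀ A₁ (fE f₀ E)) (SD A₀ A₁ (fE f₀ E)) := by
  obtain ⟨j1, j2, j3⟩ := adm_j d h
  have hA₀1 : ContDiff ℝ 1 A₀ := d.hA₀.of_le (by norm_num)
  have hA₀' : ContDiff ℝ 1 (deriv A₀) := d.hA₀.deriv' 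
  refine ⟨⟨?_, ?_, ?_, ?_⟩, SE_bound d h⟩
  · exact (EE_cont hA₀1 d.hA₁.continuous j1).comp (f := fun p : ℝ × ℝ => (max p.1 0, p.2))
      (by fun_prop)
  · exact (EE_cont hA₀' (d.hA₁.continuous_deriv (by simp)) j2).comp
      (f := fun p : ℝ × ℝ => (max p.1 0, p.2)) (by fun_prop)
  · intro t x
    exact (EE_EX_derivs d.hA₀ d.hA₁ j1 j2 j3).1 (max t 0) x
  · intro T
    rcases lt_or_ge T 0 with hT | hT
    · exact ⟨0, le_rfl, fun t ht => absurd (abs_nonneg t) (by linarith)⟩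
    obtain ⟨N, hN, hb⟩ := SD_bound d hT
    refine ⟨max N (bet K T), le_max_of_le_left hN, fun t ht x => ⟨?_, ?_⟩⟩
    · exact ((SE_bound d h t x).trans (bet_mono d.K0 (abs_nonneg _) ht)).trans (le_max_right _ _)
    · exact (hb E D h t ht x).trans (le_max_left _ _)

/-- contraction estimate -/
theorem contr (d : TData f₀ A₀ A₁ K) (h : Adm K E D) {E₂ : ℝ → ℝ → ℝ} {g g' : ℝ → ℝ → ℝ → ℝ}
    (hg : ContDiff ℝ 1 (fun p : ℝ × ℝ × ℝ => g p.1 p.2.1 p.2.2))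
    (hg0 : ∀ x v, g 0 x v = f₀ x v)
    (hgc : Continuous (fun p : ℝ × ℝ × ℝ => g' p.1 p.2.1 p.2.2)) (hgs : VSupp g')
    {T P G : ℝ} (hP : 0 ≤ P) (hG0 : 0 ≤ G)
    (hgg : ∀ t ∈ Icc 0 T, ∀ x v, g' t x v = g t x v)
    (hfP : ∀ t ∈ Icc 0 T, ∀ x v, P < |v| → fE f₀ E t x v = 0)
    (hgP : ∀ t ∈ Icc 0 T, ∀ x v, P < |v| → g t x v = 0)
    (hG : ∀ s ∈ Ioo 0 T, ∀ x v, |deriv (fun w => g s x w) v| ≤ G)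
    (htr : ∀ s ∈ Ioo 0 T, ∀ x v, deriv (fun r => g r x v) s + vhat v * deriv (fun y => g s y v) x
        - E₂ s x * deriv (fun w => g s x w) v = 0)
    {e : ℝ → ℝ} (hec : Continuous e) (hem : ∀ s t, 0 ≤ s → s ≤ t → e s ≤ e t) (he0 : 0 ≤ e 0)
    (he : ∀ s ∈ Icc 0 T, ∀ x, |E s x - E₂ s x| ≤ e s) :
    (∀ t ∈ Icc 0 T, ∀ x v, |fE f₀ E t x v - g t x v| ≤ T * (G * e t)) ∧
    (∀ t ∈ Icc 0 T, ∀ x, |EE A₀ A₁ (jcur (fE f₀ E)) t x - EE A₀ A₁ (jcur g') t x| ≤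
      ∫ s in (0:ℝ)..t, 2 * P * T * G * e s) := by
  have h1 : ∀ t ∈ Icc 0 T, ∀ x v, |fE f₀ E t x v - g t x v| ≤ T * (G * e t) := by
    intro t ht x v
    refine (stability h.good hg hg0 ht.1 (fun s hs => hG s ⟨hs.1, hs.2.trans_le ht.2⟩)
      (fun s hs => htr s ⟨hs.1, hs.2.trans_le ht.2⟩)
      (fun s hs x => (he s ⟨hs.1.le, hs.2.le.trans ht.2⟩ x).trans (hem s t hs.1.le hs.2.le)) x v).trans ?_
    have := ht.2
    have := he0.trans (hem 0 t le_rfl ht.1)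
    gcongr
  refine ⟨h1, fun t ht x => ?_⟩
  have key : ∀ σ : ℝ, |II σ (jcur (fE f₀ E)) t x - II σ (jcur g') t x| ≤
      ∫ s in (0:ℝ)..t, 2 * P * T * G * e s := by
    intro σ
    refine II_diff σ ht.1 x (adm_j d h).1 (mom_cont vhat_contDiff.continuous hgc hgs)
      (by fun_prop) fun s hs y => ?_
    have hs' : s ∈ Icc 0 T := ⟨hs.1, hs.2.trans ht.2⟩
    refine (mom_diff vhat_contDiff.continuous (fE_contDiff d.hf h.good).continuous hgc hP
      zero_le_one (hfP s hs') (fun x v hv => by rw [hgg s hs', hgP s hs' x v hv])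
      (fun v _ => (vhat_abs_lt v).le)
      (fun x v => by rw [hgg s hs']; exact h1 s hs' x v) y).trans (le_of_eq ?_)
    ring
  exact EE_diff_of (key 1) (key (-1))

end

/-- exponential series majorant -/
noncomputable def ee (c l : ℝ) (n : ℕ) (s : ℝ) : ℝ := c * ((l * s) ^ n / (n.factorial : ℝ))

theorem ee_cont (c l : ℝ) (n : ℕ) : Continuous (ee c l n) := by unfold ee; fun_prop

theorem ee_nonneg {c l : ℝ} (hc : 0 ≤ c) (hl : 0 ≤ l) (n : ℕ) {s : ℝ} (hs : 0 ≤ s) :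
    0 ≤ ee c l n s := by unfold ee; positivity

theorem ee_mono {c l : ℝ} (hc : 0 ≤ c) (hl : 0 ≤ l) (n : ℕ) (s t : ℝ) (hs : 0 ≤ s) (hst : s ≤ t) :
    ee c l n s ≤ ee c l n t := by unfold ee; gcongr

theorem ee_int (c l : ℝ) (n : ℕ) (t : ℝ) :
    ∫ s in (0:ℝ)..t, l * ee c l n s = ee c l (n + 1) t := by
  have hd : ∀ s, HasDerivAt (ee c l (n + 1)) (l * ee c l n s) s := by
    intro s
    unfold ee
    have := ((((hasDerivAt_id s).const_mul l).pow (n + 1)).div_const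
      ((n + 1).factorial : ℝ)).const_mul c
    refine this.congr_deriv ?_
    have h1 : ((n.factorial : ℕ) : ℝ) ≠ 0 := by positivity
    have h2 : ((n : ℝ) + 1) ≠ 0 := by positivity
    rw [Nat.factorial_succ]
    push_cast
    simp only [id, Nat.add_sub_cancel]
    field_simp
  have hec := ee_cont c l n
  rw [integral_eq_sub_of_hasDerivAt (fun s _ => hd s)
    (Continuous.intervalIntegrable (by fun_prop) _ _)]
  simp [ee]

theorem ee_summable (c l t : ℝ) : Summable fun n => ee c l n t := by
  unfold ee
  exact (Real.summable_pow_div_factorial (l * t)).mul_left c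

/-- strip limits -/
theorem lim_strip {Q : ℕ → ℝ → ℝ → ℝ} (hc : ∀ n, Continuous fun p : ℝ × ℝ => Q n p.1 p.2)
    (hu : ∀ T : ℝ, 0 ≤ T → ∃ u : ℕ → ℝ, Summable u ∧
      ∀ n t x, |t| ≤ T → |Q (n + 1) t x - Q n t x| ≤ u n) :
    ∃ M : ℝ → ℝ → ℝ, (Continuous fun p : ℝ × ℝ => M p.1 p.2) ∧
      ∀ T : ℝ, 0 ≤ T → ∀ ε > 0, ∃ N : ℕ, ∀ n ≥ N, ∀ t x, |t| ≤ T → |Q n t x - M t x| ≤ ε := by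
  have hdist : ∀ T : ℝ, 0 ≤ T → ∃ u : ℕ → ℝ, Summable u ∧
      ∀ t x, |t| ≤ T → ∀ n, dist (Q n t x) (Q n.succ t x) ≤ u n := by
    intro T hT
    obtain ⟨u, hs, h⟩ := hu T hT
    refine ⟨u, hs, fun t x ht n => ?_⟩
    rw [dist_comm]
    exact h n t x ht
  have hex : ∀ t x, ∃ y, Filter.Tendsto (fun n => Q n t x) Filter.atTop (nhds y) := by
    intro t x
    obtain ⟨u, hs, h⟩ := hdist |t| (abs_nonneg t)
    exact cauchySeq_tendsto_of_complete (cauchySeq_of_dist_le_of_summable u (h t x le_rfl) hs)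
  choose M hM using hex
  have hun : ∀ T : ℝ, 0 ≤ T → ∀ ε > 0, ∃ N : ℕ, ∀ n ≥ N, ∀ t x, |t| ≤ T →
      |Q n t x - M t x| ≤ ε := by
    intro T hT ε hε
    obtain ⟨u, hs, h⟩ := hdist T hT
    have ht := tendsto_sum_nat_add u
    obtain ⟨N, hN⟩ := Filter.eventually_atTop.1 (ht.eventually (gt_mem_nhds hε))
    refine ⟨N, fun n hn t x htT => ?_⟩
    have h1 := dist_le_tsum_of_dist_le_of_tendsto u (h t x htT) hs (hM t x) n
    have h2 := hN n hn
    simp only [add_comm _ n] at h2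
    exact h1.trans h2.le
  refine ⟨M, ?_, hun⟩
  rw [continuous_iff_continuousAt]
  rintro ⟨t, x⟩
  have hnb : {p : ℝ × ℝ | |p.1| < |t| + 1} ∈ nhds (t, x) := by
    have hc : Continuous fun p : ℝ × ℝ => |p.1| := by fun_prop
    exact hc.continuousAt.eventually (gt_mem_nhds (by simp))
  have hT : TendstoUniformlyOn (fun n (p : ℝ × ℝ) => Q n p.1 p.2) (fun p => M p.1 p.2) Filter.atTop
      {p : ℝ × ℝ | |p.1| < |t| + 1} := by
    rw [Metric.tendstoUniformlyOn_iff]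
    intro ε hε
    obtain ⟨N, hN⟩ := hun (|t| + 1) (by positivity) (ε / 2) (by positivity)
    filter_upwards [Filter.eventually_ge_atTop N] with n hn p hp
    rw [dist_comm]
    exact (hN n hn p.1 p.2 (le_of_lt hp)).trans_lt (by linarith)
  exact (hT.continuousOn (Filter.Frequently.of_forall fun n => (hc n).continuousOn)).continuousAt hnb

/-- the iteration -/
noncomputable def En (f₀ : ℝ → ℝ → ℝ) (A₀ A₁ : ℝ → ℝ) : ℕ → ℝ → ℝ → ℝ
  | 0 => fun _ _ => 0
  | n + 1 => SE A₀ A₁ (fE f₀ (En f₀ A₀ A₁ n))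

/-- derivative of the iteration -/
noncomputable def Dn (f₀ : ℝ → ℝ → ℝ) (A₀ A₁ : ℝ → ℝ) : ℕ → ℝ → ℝ → ℝ
  | 0 => fun _ _ => 0
  | n + 1 => SD A₀ A₁ (fE f₀ (En f₀ A₀ A₁ n))

section
variable {f₀ : ℝ → ℝ → ℝ} {A₀ A₁ : ℝ → ℝ} {K : ℝ}

theorem En_adm (d : TData f₀ A₀ A₁ K) (n : ℕ) : Adm K (En f₀ A₀ A₁ n) (Dn f₀ A₀ A₁ n) := by
  induction n with
  | zero => exact adm_zero d.K0
  | succ n ih => exact adm_step d ih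

theorem En_max (n : ℕ) (t x : ℝ) : En f₀ A₀ A₁ n (max t 0) x = En f₀ A₀ A₁ n t x := by
  cases n with
  | zero => rfl
  | succ n => simp [En, SE]

theorem En_dv (d : TData f₀ A₀ A₁ K) {T : ℝ} (hT : 0 ≤ T) : ∃ G, 0 ≤ G ∧ ∀ n, ∀ s ∈ Icc 0 T, ∀ x v,
    |deriv (fun w => fE f₀ (En f₀ A₀ A₁ n) s x w) v| ≤ G := by
  obtain ⟨B, hB, hb⟩ := SD_bound d (T := T + 1) (by linarith)
  have hK := d.K0
  refine ⟨K * Real.exp ((1 + B) * T), by positivity, fun n s hs x v => ?_⟩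
  refine fE_dv_le (En_adm d n).good d.K0 d.lip hB ?_ (by rw [abs_of_nonneg hs.1]; exact hs.2) x v
  intro t ht x
  cases n with
  | zero => simpa [Dn] using hB
  | succ n => exact hb _ _ (En_adm d n) t ht x

/-- compare an admissible field with an iterate -/
theorem En_contr (d : TData f₀ A₀ A₁ K) {T : ℝ} (hT : 0 ≤ T) : ∃ G l, 0 ≤ G ∧ 0 ≤ l ∧
    ∀ n E D, Adm K E D → ∀ e : ℝ → ℝ, Continuous e → (∀ s t, 0 ≤ s → s ≤ t → e s ≤ e t) → 0 ≤ e 0 →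
    (∀ s ∈ Icc 0 T, ∀ x, |E s x - En f₀ A₀ A₁ n s x| ≤ e s) →
    (∀ t ∈ Icc 0 T, ∀ x v, |fE f₀ E t x v - fE f₀ (En f₀ A₀ A₁ n) t x v| ≤ G * e t) ∧
    (∀ t ∈ Icc 0 T, ∀ x, |SE A₀ A₁ (fE f₀ E) t x - En f₀ A₀ A₁ (n + 1) t x| ≤
      ∫ s in (0:ℝ)..t, l * e s) := by
  obtain ⟨G, hG, hb⟩ := En_dv d hT
  have hP := PP_nonneg d.K0 hT
  refine ⟨T * G, 2 * PP K T * T * G, by positivity, by positivity, ?_⟩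
  intro n E D h e hec hem he0 he
  have hn := En_adm d n
  have hsupp : ∀ {E D}, Adm K E D → ∀ t ∈ Icc 0 T, ∀ x v, PP K T < |v| → fE f₀ E t x v = 0 :=
    fun h t ht x v hv => adm_supp d h (T := T) (by rw [abs_of_nonneg ht.1]; exact ht.2) x v
      (Or.inr hv)
  have hf := fE_contDiff d.hf hn.good
  obtain ⟨h1, h2⟩ := contr d h (E₂ := En f₀ A₀ A₁ n) hf
    (fE_zero hn.good) hf.continuous (adm_vsupp d hn) (T := T) hP hG (fun _ _ _ _ => rfl) (hsupp h)
    (hsupp hn) (fun s hs => hb n s (Ioo_subset_Icc_self hs))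
    (fun s _ => fE_transport d.hf hn.good s) hec hem he0 he
  refine ⟨fun t ht x v => (h1 t ht x v).trans (le_of_eq (by ring)), fun t ht x => ?_⟩
  have := h2 t ht x
  simp only [En, SE, max_eq_left ht.1]
  exact this

theorem En_iter (d : TData f₀ A₀ A₁ K) {T : ℝ} (hT : 0 ≤ T) : ∃ c l C, 0 ≤ c ∧ 0 ≤ l ∧ 0 ≤ C ∧
    ∀ n, (∀ t, |t| ≤ T → ∀ x, |En f₀ A₀ A₁ (n + 1) t x - En f₀ A₀ A₁ n t x| ≤ ee c l n T) ∧
    (∀ t, |t| ≤ T → ∀ x, |Dn f₀ A₀ A₁ (n + 2) t x - Dn f₀ A₀ A₁ (n + 1) t x| ≤ C * ee c l n T) := by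
  obtain ⟨G, l, hG, hl, hk⟩ := En_contr d hT
  obtain ⟨N, hN, hd⟩ := SD_diff d hT
  have hc := bet_nonneg d.K0 T
  have key : ∀ n, ∀ t ∈ Icc 0 T, ∀ x, |En f₀ A₀ A₁ (n + 1) t x - En f₀ A₀ A₁ n t x| ≤
      ee (bet K T) l n t := by
    intro n
    induction n with
    | zero =>
      intro t ht x
      simp only [ee, En, pow_zero, Nat.factorial_zero, Nat.cast_one, div_one, mul_one, sub_zero]
      exact (SE_bound d (adm_zero d.K0) t x).trans
        (bet_mono d.K0 (abs_nonneg _) (by rw [abs_of_nonneg ht.1]; exact ht.2))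
    | succ n ih =>
      intro t ht x
      rw [← ee_int]
      exact (hk n _ _ (En_adm d (n + 1)) (ee (bet K T) l n) (ee_cont _ _ _) (ee_mono hc hl n)
        (ee_nonneg hc hl n le_rfl) ih).2 t ht x
  refine ⟨bet K T, l, N * (G + 1), hc, hl, by positivity, fun n => ⟨fun t ht x => ?_, fun t ht x => ?_⟩⟩
  · have h1 := max_abs_le ht
    rw [← En_max (n + 1), ← En_max n t x]
    exact (key n _ h1 x).trans (ee_mono hc hl n _ _ h1.1 h1.2)
  · have h1 := (hk n _ _ (En_adm d (n + 1)) (ee (bet K T) l n) (ee_cont _ _ _) (ee_mono hc hl n)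
        (ee_nonneg hc hl n le_rfl) (key n)).1
    have h2 := hd _ _ _ _ (En_adm d (n + 1)) (En_adm d n) (G * ee (bet K T) l n T)
      (ee (bet K T) l n T) (ee_nonneg hc hl n hT)
      (fun t ht x v => (h1 t ht x v).trans
        (mul_le_mul_of_nonneg_left (ee_mono hc hl n _ _ ht.1 ht.2) hG))
      (fun t ht x => (key n t ht x).trans (ee_mono hc hl n _ _ ht.1 ht.2)) t ht x
    refine h2.trans (le_of_eq ?_)
    ring

/-- fixed point -/
theorem exists_fixed (d : TData f₀ A₀ A₁ K) : ∃ E D, Adm K E D ∧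
    ∀ t x, E t x = SE A₀ A₁ (fE f₀ E) t x := by
  obtain ⟨E, hEc, hE⟩ := lim_strip (Q := fun n => En f₀ A₀ A₁ (n + 1))
    (fun n => (En_adm d (n + 1)).good.cont) (fun T hT => by
      obtain ⟨c, l, C, -, -, -, h⟩ := En_iter d hT
      exact ⟨fun n => ee c l (n + 1) T, (summable_nat_add_iff 1).2 (ee_summable c l T),
        fun n t x ht => (h (n + 1)).1 t ht x⟩)
  obtain ⟨D, hDc, hD⟩ := lim_strip (Q := fun n => Dn f₀ A₀ A₁ (n + 1))
    (fun n => (En_adm d (n + 1)).good.cont') (fun T hT => by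
      obtain ⟨c, l, C, -, -, -, h⟩ := En_iter d hT
      exact ⟨fun n => C * ee c l n T, (ee_summable c l T).mul_left C,
        fun n t x ht => (h n).2 t ht x⟩)
  have tend : ∀ {Q : ℕ → ℝ → ℝ → ℝ} {M : ℝ → ℝ → ℝ}, (∀ T : ℝ, 0 ≤ T → ∀ ε > 0, ∃ N : ℕ, ∀ n ≥ N,
      ∀ t x, |t| ≤ T → |Q n t x - M t x| ≤ ε) → ∀ t,
      TendstoUniformly (fun n => Q n t) (M t) Filter.atTop := by
    intro Q M h t
    rw [Metric.tendstoUniformly_iff]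
    intro ε hε
    obtain ⟨N, hN⟩ := h |t| (abs_nonneg t) (ε / 2) (by positivity)
    filter_upwards [Filter.eventually_ge_atTop N] with n hn x
    rw [dist_comm]
    exact (hN n hn t x le_rfl).trans_lt (by linarith)
  have tE := tend hE
  have tD := tend hD
  have hbd : ∀ t x, |E t x| ≤ bet K |t| := fun t x =>
    le_of_tendsto ((tE t).tendsto_at x).abs
      (Filter.Eventually.of_forall fun n => (En_adm d (n + 1)).bd t x)
  have hadm : Adm K E D := by
    refine ⟨⟨hEc, hDc, fun t x => ?_, fun T => ?_⟩, hbd⟩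
    · exact hasDerivAt_of_tendstoUniformly (tD t)
        (Filter.Eventually.of_forall fun n x => (En_adm d (n + 1)).good.hasD t x)
        (fun x => (tE t).tendsto_at x) x
    · rcases lt_or_ge T 0 with hT | hT
      · exact ⟨0, le_rfl, fun t ht => absurd (abs_nonneg t) (by linarith)⟩
      obtain ⟨N, hN, hb⟩ := SD_bound d hT
      refine ⟨max N (bet K T), le_max_of_le_left hN, fun t ht x => ⟨?_, ?_⟩⟩
      · exact ((hbd t x).trans (bet_mono d.K0 (abs_nonneg _) ht)).trans (le_max_right _ _)
      · exact (le_of_tendsto ((tD t).tendsto_at x).abs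
          (Filter.Eventually.of_forall fun n => hb _ _ (En_adm d n) t ht x)).trans (le_max_left _ _)
  refine ⟨E, D, hadm, fun t x => ?_⟩
  have hEmax : E t x = E (max t 0) x := by
    refine tendsto_nhds_unique ((tE t).tendsto_at x) ?_
    refine ((tE (max t 0)).tendsto_at x).congr fun n => ?_
    exact En_max (n + 1) t x
  have hSmax : SE A₀ A₁ (fE f₀ E) t x = SE A₀ A₁ (fE f₀ E) (max t 0) x := by simp [SE]
  rw [hEmax, hSmax]
  have ht : 0 ≤ max t 0 := le_max_right _ _
  set τ := max t 0
  obtain ⟨G, l, hG, hl, hk⟩ := En_contr d ht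
  have hle : ∀ ε > 0, |SE A₀ A₁ (fE f₀ E) τ x - E τ x| ≤ (τ * l + 1) * ε := by
    intro ε hε
    obtain ⟨N, hN⟩ := hE τ ht ε hε
    have h1 := (hk (N + 1) _ _ hadm (fun _ => ε) continuous_const (fun _ _ _ _ => le_rfl) hε.le
      (fun s hs x => by
        rw [abs_sub_comm]
        exact hN N le_rfl s x (by rw [abs_of_nonneg hs.1]; exact hs.2))).2 τ ⟨ht, le_rfl⟩ x
    have h2 := hN (N + 1) (by omega) τ x (abs_of_nonneg ht).le
    rw [intervalIntegral.integral_const, sub_zero, smul_eq_mul] at h1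
    have h3 := abs_sub_le (SE A₀ A₁ (fE f₀ E) τ x) (En f₀ A₀ A₁ (N + 1 + 1) τ x) (E τ x)
    calc _ ≤ _ := h3
      _ ≤ τ * (l * ε) + ε := add_le_add h1 h2
      _ = _ := by ring
  have : |SE A₀ A₁ (fE f₀ E) τ x - E τ x| ≤ 0 := by
    refine le_of_forall_pos_le_add fun δ hδ => ?_
    have hp : 0 < τ * l + 1 := by positivity
    have := hle (δ / (τ * l + 1)) (by positivity)
    rwa [mul_div_cancel₀ _ hp.ne', ← zero_add δ] at this
  exact (sub_eq_zero.1 (abs_nonpos_iff.1 this)).symm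

end

theorem bdd_of_cs {X : Type*} [TopologicalSpace X] {h : X → ℝ} (hc : Continuous h)
    (hs : HasCompactSupport h) : ∃ C, 0 ≤ C ∧ ∀ x, |h x| ≤ C := by
  obtain ⟨C, hC⟩ := hs.exists_bound_of_continuous hc
  exact ⟨max C 0, le_max_right _ _, fun x => (hC x).trans (le_max_left _ _)⟩

theorem exists_data
    (f₀ : ℝ → ℝ → ℝ) (A₀ A₁ : ℝ → ℝ)
    (hf₀ : ContDiff ℝ 1 (fun p : ℝ × ℝ => f₀ p.1 p.2))
    (hf₀c : HasCompactSupport (fun p : ℝ × ℝ => f₀ p.1 p.2))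
    (hA₀ : ContDiff ℝ 2 A₀) (hA₀c : HasCompactSupport A₀)
    (hA₁ : ContDiff ℝ 1 A₁) (hA₁c : HasCompactSupport A₁) : ∃ K, TData f₀ A₀ A₁ K := by
  obtain ⟨m, m0, hm⟩ := bdd_of_cs hf₀.continuous hf₀c
  have hA₀' : ContDiff ℝ 1 (deriv A₀) := hA₀.deriv'
  obtain ⟨c0, c00, h0⟩ := bdd_of_cs hA₀'.continuous hA₀c.deriv
  obtain ⟨c1, c10, h1⟩ := bdd_of_cs hA₁.continuous hA₁c
  obtain ⟨c2, c20, h2⟩ := bdd_of_cs (hA₀'.continuous_deriv (by simp)) hA₀c.deriv.deriv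
  obtain ⟨c3, c30, h3⟩ := bdd_of_cs (hA₁.continuous_deriv (by simp)) hA₁c.deriv
  obtain ⟨L, hL⟩ := hf₀.lipschitzWith_of_hasCompactSupport hf₀c (by simp)
  obtain ⟨R, hR⟩ := hf₀c.isCompact.isBounded.subset_closedBall (0 : ℝ × ℝ)
  have hL0 : (0:ℝ) ≤ L := L.2
  have hRz : ∀ x v, R < |x| ∨ R < |v| → f₀ x v = 0 := by
    intro x v hxv
    by_contra hne
    have h4 := hR (subset_tsupport _ (show (x, v) ∈ Function.support _ from hne))
    rw [mem_closedBall_zero_iff, Prod.norm_def] at h4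
    have h5 := max_le_iff.1 h4
    simp only [Real.norm_eq_abs] at h5
    rcases hxv with h | h <;> linarith [h5.1, h5.2]
  have hR0 := le_abs_self R
  have hR1 := abs_nonneg R
  refine ⟨2 * (m + c0 + c1 + c2 + c3 + L + |R|), hf₀, hA₀, hA₁, by positivity, ?_, ?_, ?_, ?_, ?_,
    ?_, ?_⟩
  · intro x v hxv
    apply hRz
    exact hxv.imp (fun h => by linarith) (fun h => by linarith)
  · intro x v; have := hm (x, v); simp only at this; linarith
  · intro a b
    have := hL.dist_le_mul a b
    rw [Real.dist_eq, dist_eq_norm] at this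
    refine this.trans ?_
    gcongr
    linarith
  · intro x; linarith [h0 x]
  · intro x; linarith [h1 x]
  · intro x; linarith [h2 x]
  · intro x; linarith [h3 x]

section
variable {f₀ : ℝ → ℝ → ℝ} {A₀ A₁ : ℝ → ℝ} {K : ℝ} {E D : ℝ → ℝ → ℝ}

theorem exists_sol' (d : TData f₀ A₀ A₁ K) (h : Adm K E D)
    (hfix : ∀ t x, E t x = SE A₀ A₁ (fE f₀ E) t x) : IsGlobalToySolution f₀ A₀ A₁ (fE f₀ E) := by
  obtain ⟨j1, j2, j3⟩ := adm_j d h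
  obtain ⟨w1, w2, w3⟩ := dAlembert_main (j := jcur (fE f₀ E)) d.hA₀ d.hA₁ j1 j2 j3
  refine ⟨fE_contDiff d.hf h.good, fE_zero h.good, ?_, ?_, w1.contDiffOn, fun t _ x => w3 t x⟩
  · intro T hT
    refine ⟨max (K + T) (PP K T), fun t ht x v hxv => ?_⟩
    refine adm_supp d h (T := T) (by rw [abs_of_nonneg ht.1]; exact ht.2) x v ?_
    exact hxv.imp (fun h => (le_max_left _ _).trans_lt h) (fun h => (le_max_right _ _).trans_lt h)
  · intro t ht x v
    have h1 := fE_transport d.hf h.good t x v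
    rw [hfix t x, SE, max_eq_left ht, ← w2] at h1
    exact h1

/-- `f`-constant extension to negative times -/
def gext (g : ℝ → ℝ → ℝ → ℝ) (t x v : ℝ) : ℝ := g (max t 0) x v

theorem pt_gext {g : ℝ → ℝ → ℝ → ℝ} (hA₀ : ContDiff ℝ 1 A₀) (hA₁ : Continuous A₁)
    (hj : Continuous fun p : ℝ × ℝ => jcur (gext g) p.1 p.2) {t : ℝ} (ht : 0 < t) (x : ℝ) :
    pt (dAlembert A₀ A₁ (jcur g)) t x = EE A₀ A₁ (jcur (gext g)) t x := by
  rw [← (dAlembert_hasDerivAt_t hA₀ hA₁ hj t x).deriv]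
  apply Filter.EventuallyEq.deriv_eq
  filter_upwards [lt_mem_nhds ht] with r hr
  unfold dAlembert
  congr 2
  apply intervalIntegral.integral_congr
  intro s hs
  rw [uIcc_of_le hr.le] at hs
  have : ∀ y, jcur g s y = jcur (gext g) s y := by
    intro y; simp [jcur, gext, max_eq_left hs.1]
  simp only [this]

theorem unique' (d : TData f₀ A₀ A₁ K) (h : Adm K E D)
    (hfix : ∀ t x, E t x = SE A₀ A₁ (fE f₀ E) t x) {g : ℝ → ℝ → ℝ → ℝ}
    (hg : IsGlobalToySolution f₀ A₀ A₁ g) {T : ℝ} (hT : 0 < T) (x v : ℝ) :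
    g T x v = fE f₀ E T x v := by
  obtain ⟨g1, g2, g3, g4, -, -⟩ := hg
  have hA₀1 : ContDiff ℝ 1 A₀ := d.hA₀.of_le (by norm_num)
  have hgc : Continuous (fun p : ℝ × ℝ × ℝ => gext g p.1 p.2.1 p.2.2) :=
    g1.continuous.comp (f := fun p : ℝ × ℝ × ℝ => (max p.1 0, p.2.1, p.2.2)) (by fun_prop)
  have hgs : VSupp (gext g) := by
    intro S
    obtain ⟨R, hR⟩ := g3 (|S| + 1) (by positivity)
    refine ⟨R, fun t ht x v hv => hR _ (max_abs_le ?_) x v (Or.inr hv)⟩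
    linarith [le_abs_self S]
  have hj : Continuous fun p : ℝ × ℝ => jcur (gext g) p.1 p.2 :=
    mom_cont vhat_contDiff.continuous hgc hgs
  obtain ⟨R, hR⟩ := g3 T hT
  set P := max R (PP K T)
  have hP : 0 ≤ P := le_max_of_le_right (PP_nonneg d.K0 hT.le)
  have hRP : R ≤ P := le_max_left _ _
  have hfP : ∀ t ∈ Icc 0 T, ∀ x v, P < |v| → fE f₀ E t x v = 0 := fun t ht x v hv =>
    adm_supp d h (T := T) (by rw [abs_of_nonneg ht.1]; exact ht.2) x v
      (Or.inr ((le_max_right _ _).trans_lt hv))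
  have hgP : ∀ t ∈ Icc 0 T, ∀ x v, P < |v| → g t x v = 0 := fun t ht x v hv =>
    hR t ht x v (Or.inr (hRP.trans_lt hv))
  obtain ⟨-, -, c3, -, -, -⟩ := partials_cont g1
  have hcomp : IsCompact (Icc 0 T ×ˢ Icc (-P) P ×ˢ Icc (-P) P) :=
    isCompact_Icc.prod (isCompact_Icc.prod isCompact_Icc)
  obtain ⟨G, hGb⟩ := hcomp.exists_bound_of_continuousOn c3.continuousOn
  obtain ⟨m, hmb⟩ := hcomp.exists_bound_of_continuousOn g1.continuous.continuousOn
  have hG : ∀ s ∈ Icc 0 T, ∀ x v, |deriv (fun w => g s x w) v| ≤ max G 0 := by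
    intro s hs x v
    by_cases hx : P < |x|
    · rw [show (fun w => g s x w) = fun _ => 0 from
        funext fun w => hR s hs x w (Or.inl (hRP.trans_lt hx)), deriv_const, abs_zero]
      exact le_max_right _ _
    by_cases hv : P < |v|
    · have hev : (fun w => g s x w) =ᶠ[nhds v] fun _ => 0 := by
        have : ∀ᶠ w in nhds v, P < |w| :=
          (continuous_abs.tendsto v).eventually (lt_mem_nhds hv)
        filter_upwards [this] with w hw using hgP s hs x w hw
      rw [hev.deriv_eq, deriv_const, abs_zero]
      exact le_max_right _ _
    · exact (hGb (s, x, v) ⟨hs, abs_le.1 (not_lt.1 hx), abs_le.1 (not_lt.1 hv)⟩).trans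
        (le_max_left _ _)
  have hm : ∀ s ∈ Icc 0 T, ∀ x v, |g s x v| ≤ max m 0 := by
    intro s hs x v
    by_cases hx : P < |x|
    · rw [hR s hs x v (Or.inl (hRP.trans_lt hx)), abs_zero]
      exact le_max_right _ _
    by_cases hv : P < |v|
    · rw [hgP s hs x v hv, abs_zero]
      exact le_max_right _ _
    · exact (hmb (s, x, v) ⟨hs, abs_le.1 (not_lt.1 hx), abs_le.1 (not_lt.1 hv)⟩).trans
        (le_max_left _ _)
  have hgg : ∀ t ∈ Icc 0 T, ∀ x v, gext g t x v = g t x v := fun t ht x v => by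
    simp [gext, max_eq_left ht.1]
  have htr : ∀ s ∈ Ioo 0 T, ∀ x v, deriv (fun r => g r x v) s + vhat v * deriv (fun y => g s y v) x
        - EE A₀ A₁ (jcur (gext g)) s x * deriv (fun w => g s x w) v = 0 := by
    intro s hs x v
    have := g4 s hs.1.le x v
    rwa [pt_gext hA₀1 d.hA₁.continuous hj hs.1] at this
  have hfixE : ∀ t ∈ Icc 0 T, ∀ x, E t x = EE A₀ A₁ (jcur (fE f₀ E)) t x := fun t ht x => by
    rw [hfix t x, SE, max_eq_left ht.1]
  have hG0 : 0 ≤ max G 0 := le_max_right _ _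
  have hm0 : 0 ≤ max m 0 := le_max_right _ _
  have hK := d.K0
  set c := T * (2 * P * (1 * (K / 2 + max m 0)))
  have hc : 0 ≤ c := by positivity
  set l := 2 * P * T * max G 0
  have hl : 0 ≤ l := by positivity
  have key : ∀ n : ℕ, ∀ t ∈ Icc 0 T, ∀ x,
      |E t x - EE A₀ A₁ (jcur (gext g)) t x| ≤ ee c l n t := by
    intro n
    induction n with
    | zero =>
      intro t ht x
      simp only [ee, pow_zero, Nat.factorial_zero, Nat.cast_one, div_one, mul_one]
      rw [hfixE t ht]
      have hII : ∀ σ : ℝ, |II σ (jcur (fE f₀ E)) t x - II σ (jcur (gext g)) t x| ≤ c := by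
        intro σ
        have := II_diff σ (G₁ := jcur (fE f₀ E)) (G₂ := jcur (gext g)) ht.1 x (adm_j d h).1 hj
          (d := fun _ => 2 * P * (1 * (K / 2 + max m 0))) continuous_const (fun s hs y => by
            have hs' : s ∈ Icc 0 T := ⟨hs.1, hs.2.trans ht.2⟩
            refine mom_diff vhat_contDiff.continuous (fE_contDiff d.hf h.good).continuous hgc hP
              zero_le_one (hfP s hs') (fun x v hv => by rw [hgg s hs', hgP s hs' x v hv])
              (fun v _ => (vhat_abs_lt v).le) (fun x v => ?_) y
            rw [hgg s hs']
            exact (abs_sub _ _).trans (add_le_add (fE_abs_le d.fb s x v) (hm s hs' x v)))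
        rw [intervalIntegral.integral_const, sub_zero, smul_eq_mul] at this
        refine this.trans ?_
        exact mul_le_mul_of_nonneg_right ht.2 (by positivity)
      exact EE_diff_of (hII 1) (hII (-1))
    | succ n ih =>
      intro t ht x
      rw [← ee_int, hfixE t ht]
      exact (contr d h g1 g2 hgc hgs hP hG0 hgg hfP hgP
        (fun s hs => hG s (Ioo_subset_Icc_self hs)) htr (ee_cont c l n) (ee_mono hc hl n)
        (ee_nonneg hc hl n le_rfl) ih).2 t ht x
  have hfin : ∀ n : ℕ, |fE f₀ E T x v - g T x v| ≤ T * (max G 0 * ee c l n T) := fun n =>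
    (contr d h g1 g2 hgc hgs hP hG0 hgg hfP hgP
        (fun s hs => hG s (Ioo_subset_Icc_self hs)) htr (ee_cont c l n) (ee_mono hc hl n)
        (ee_nonneg hc hl n le_rfl) (key n)).1 T ⟨hT.le, le_rfl⟩ x v
  have hlim : Filter.Tendsto (fun n : ℕ => T * (max G 0 * ee c l n T)) Filter.atTop (nhds 0) := by
    have := (((ee_summable c l T).tendsto_atTop_zero).const_mul (max G 0)).const_mul T
    simpa using this
  have h0 := ge_of_tendsto' hlim hfin
  exact (sub_eq_zero.1 (abs_nonpos_iff.1 h0)).symm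

end

theorem global_existence_uniqueness_toy
    (f₀ : ℝ → ℝ → ℝ) (A₀ A₁ : ℝ → ℝ)
    (hf₀ : ContDiff ℝ 1 (fun p : ℝ × ℝ => f₀ p.1 p.2))
    (hf₀c : HasCompactSupport (fun p : ℝ × ℝ => f₀ p.1 p.2))
    (hA₀ : ContDiff ℝ 2 A₀) (hA₀c : HasCompactSupport A₀)
    (hA₁ : ContDiff ℝ 1 A₁) (hA₁c : HasCompactSupport A₁) :
    ∃ f : ℝ → ℝ → ℝ → ℝ, IsGlobalToySolution f₀ A₀ A₁ f ∧
      ∀ g : ℝ → ℝ → ℝ → ℝ, IsGlobalToySolution f₀ A₀ A₁ g →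
        ∀ t ≥ (0:ℝ), ∀ x v : ℝ, g t x v = f t x v := by
  obtain ⟨K, d⟩ := exists_data f₀ A₀ A₁ hf₀ hf₀c hA₀ hA₀c hA₁ hA₁c
  obtain ⟨E, D, h, hfix⟩ := exists_fixed d
  refine ⟨fE f₀ E, exists_sol' d h hfix, fun g hg t ht x v => ?_⟩
  rcases (show 0 ≤ t from ht).eq_or_lt with rfl | ht'
  · rw [hg.2.1, fE_zero h.good]
  · exact unique' d h hfix hg ht' x v
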